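/- Let μ be a compactly supported symmetric Borel probability measure on ℝ whose absolutely continuous part (with respect to Lebesgue measure) is nonzero, let B = inf{|λ| : λ ∈ supp μ}, and let F be a continuous centered stationary Gaussian process with spectral measure μ. Then there exist constants c, d₁, d₂ > 0 such that for every T ≥ e^8 and every ε with d₁·(log T)/√T ≤ ε ≤ d₂, one has P( N_F(T) ≤ (B/π)·T − ε·T ) ≤ exp( −c·(ε/log ε)⁴·T² ). -/

import Mathlib

open MeasureTheory ProbabilityTheory Set ENNReal NNReal

/-- The covariance kernel of a spectral measure: `k(t) = ∫ cos (λ t) dμ(λ)`. -/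
noncomputable def covKernel (μ : Measure ℝ) (t : ℝ) : ℝ := ∫ l, Real.cos (l * t) ∂μ

/-- `F` is a continuous centered stationary Gaussian process on `(Ω, P)` with spectral
measure `μ`: sample paths are continuous and every finite linear combination
`∑ cᵢ F_{tᵢ}` is a centered real Gaussian with variance `∑ᵢⱼ cᵢ cⱼ k(tᵢ - tⱼ)`. -/
def IsSGP {Ω : Type*} [MeasurableSpace Ω] (P : Measure Ω) (μ : Measure ℝ)
    (F : ℝ → Ω → ℝ) : Prop :=
  (∀ ω, Continuous fun t => F t ω) ∧
  ∀ (n : ℕ) (t : Fin n → ℝ) (c : Fin n → ℝ),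
    P.map (fun ω => ∑ i, c i * F (t i) ω) =
      gaussianReal 0 (∑ i, ∑ j, c i * c j * covKernel μ (t i - t j)).toNNReal

/-- The zero count `N_F(T)` as an extended natural number. -/
noncomputable def zeroCount {Ω : Type*} (F : ℝ → Ω → ℝ) (T : ℝ) (ω : Ω) : ℕ∞ :=
  {t ∈ Set.Icc (0:ℝ) T | F t ω = 0}.encard

/-- The topological support of a Borel measure on ℝ. -/
def msupport (μ : Measure ℝ) : Set ℝ := {x : ℝ | ∀ U ∈ nhds x, 0 < μ U}

section SGP

variable {Ω : Type*} [MeasurableSpace Ω] {P : Measure Ω} {μ : Measure ℝ} {F : ℝ → Ω → ℝ}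

lemma normSq_sum_exp {k : ℕ} (t c : Fin k → ℝ) (l : ℝ) :
    ‖∑ i, (c i : ℂ) * Complex.exp (((l * t i : ℝ) : ℂ) * Complex.I)‖ ^ 2 =
      ∑ i, ∑ j, c i * c j * Real.cos (l * (t i - t j)) := by
  have h : ∑ i, (c i : ℂ) * Complex.exp (((l * t i : ℝ) : ℂ) * Complex.I) =
      ((∑ i, c i * Real.cos (l * t i) : ℝ) : ℂ) +
        ((∑ i, c i * Real.sin (l * t i) : ℝ) : ℂ) * Complex.I := by
    push_cast
    rw [Finset.sum_mul, ← Finset.sum_add_distrib]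
    refine Finset.sum_congr rfl fun i _ => ?_
    rw [Complex.exp_mul_I]
    ring
  rw [h, ← Complex.normSq_eq_norm_sq, Complex.normSq_add_mul_I, sq, sq,
    Finset.sum_mul_sum, Finset.sum_mul_sum, ← Finset.sum_add_distrib]
  refine Finset.sum_congr rfl fun i _ => ?_
  rw [← Finset.sum_add_distrib]
  refine Finset.sum_congr rfl fun j _ => ?_
  rw [mul_sub, Real.cos_sub]
  ring

lemma sum_covKernel_eq [IsProbabilityMeasure μ]
    {k : ℕ} (t c : Fin k → ℝ) :
    ∑ i, ∑ j, c i * c j * covKernel μ (t i - t j) =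
      ∫ l, ‖∑ i, (c i : ℂ) * Complex.exp (((l * t i : ℝ) : ℂ) * Complex.I)‖ ^ 2 ∂μ := by
  simp_rw [normSq_sum_exp, covKernel]
  have h_int : ∀ a b : ℝ, Integrable (fun l => a * Real.cos (l * b)) μ := fun a b =>
    (Integrable.of_bound (C := 1) (by fun_prop)
      (Filter.Eventually.of_forall fun l => Real.abs_cos_le_one _)).const_mul a
  rw [integral_finsetSum _ fun i _ => integrable_finsetSum _ fun j _ => h_int _ _]
  refine Finset.sum_congr rfl fun i _ => ?_
  rw [integral_finsetSum _ fun j _ => h_int _ _]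
  refine Finset.sum_congr rfl fun j _ => ?_
  rw [integral_const_mul]

lemma IsSGP.map_eq [IsProbabilityMeasure μ]
    (hF : IsSGP P μ F) {k : ℕ} (t c : Fin k → ℝ) :
    P.map (fun ω => ∑ i, c i * F (t i) ω) = gaussianReal 0
      (∫ l, ‖∑ i, (c i : ℂ) * Complex.exp (((l * t i : ℝ) : ℂ) * Complex.I)‖ ^ 2 ∂μ).toNNReal := by
  rw [hF.2, sum_covKernel_eq]

lemma IsSGP.aemeasurable (hF : IsSGP P μ F) (s : ℝ) : AEMeasurable (F s) P := by
  have h := hF.2 1 (fun _ => s) (fun _ => 1)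
  simp only [Finset.univ_unique, Finset.sum_singleton, one_mul] at h
  by_contra hc
  have h0 : P.map (fun ω => F s ω) = 0 := Measure.map_of_not_aemeasurable hc
  rw [h0] at h
  exact IsProbabilityMeasure.ne_zero _ h.symm

lemma IsSGP.ae_ne_zero [IsProbabilityMeasure μ]
    (hF : IsSGP P μ F) (s : ℝ) : ∀ᵐ ω ∂P, F s ω ≠ 0 := by
  have h := hF.2 1 (fun _ => s) (fun _ => 1)
  simp only [Finset.univ_unique, Finset.sum_singleton, one_mul, sub_self, covKernel, mul_zero,
    Real.cos_zero, integral_const, probReal_univ, smul_eq_mul, mul_one, Real.toNNReal_one] at h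
  have h1 : ∀ᵐ x ∂(P.map (F s)), x ≠ 0 := by
    have : NullSingletonClass (gaussianReal 0 1) := nullSingletonClass_gaussianReal one_ne_zero
    rw [show P.map (F s) = gaussianReal 0 1 from h]
    exact Measure.ae_ne _ _
  exact ae_of_ae_map (hF.aemeasurable s) h1

lemma IsSGP.measure_le_sum [IsProbabilityMeasure P] [IsProbabilityMeasure μ]
    (hF : IsSGP P μ F) {k : ℕ} (t c : Fin k → ℝ) {σ x : ℝ}
    (hσ : 0 < σ) (hx : 0 ≤ x)
    (hv : ∫ l, ‖∑ i, (c i : ℂ) * Complex.exp (((l * t i : ℝ) : ℂ) * Complex.I)‖ ^ 2 ∂μ ≤ σ ^ 2) :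
    P {ω | x ≤ ∑ i, c i * F (t i) ω} ≤ ENNReal.ofReal (Real.exp (-(x ^ 2 / (2 * σ ^ 2)))) := by
  have hmap := hF.map_eq t c
  set v := ∫ l, ‖∑ i, (c i : ℂ) * Complex.exp (((l * t i : ℝ) : ℂ) * Complex.I)‖ ^ 2 ∂μ
  have hv0 : 0 ≤ v := integral_nonneg fun l => by positivity
  have hm := mgf_gaussianReal hmap (x / σ ^ 2)
  have hs : 0 ≤ x / σ ^ 2 := by positivity
  have hae : AEMeasurable (fun ω => ∑ i, c i * F (t i) ω) P :=
    Finset.aemeasurable_fun_sum _ fun i _ => (hF.aemeasurable _).const_mul _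
  have h_int : Integrable (fun ω => Real.exp (x / σ ^ 2 * ∑ i, c i * F (t i) ω)) P := by
    rw [← mgf_pos_iff, hm]
    positivity
  have h := measure_ge_le_exp_mul_mgf (μ := P) (X := fun ω => ∑ i, c i * F (t i) ω) x hs h_int
  rw [hm, Real.coe_toNNReal _ hv0, ← Real.exp_add] at h
  rw [← ENNReal.ofReal_toReal (measure_ne_top P _)]
  refine ENNReal.ofReal_le_ofReal (h.trans (Real.exp_le_exp.2 ?_))
  have h2 : v * (x / σ ^ 2) ^ 2 / 2 ≤ σ ^ 2 * (x / σ ^ 2) ^ 2 / 2 := by gcongr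
  have h3 : σ ^ 2 * (x / σ ^ 2) ^ 2 / 2 = x ^ 2 / (2 * σ ^ 2) := by
    field_simp
  have h4 : -(x / σ ^ 2) * x = - 2 * (x ^ 2 / (2 * σ ^ 2)) := by
    field_simp
  rw [h4]
  linarith

lemma IsSGP.measure_le_abs_sum [IsProbabilityMeasure P] [IsProbabilityMeasure μ]
    (hF : IsSGP P μ F) {k : ℕ} (t c : Fin k → ℝ) {σ x : ℝ}
    (hσ : 0 < σ) (hx : 0 ≤ x)
    (hv : ∫ l, ‖∑ i, (c i : ℂ) * Complex.exp (((l * t i : ℝ) : ℂ) * Complex.I)‖ ^ 2 ∂μ ≤ σ ^ 2) :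
    P {ω | x ≤ |∑ i, c i * F (t i) ω|} ≤
      ENNReal.ofReal (2 * Real.exp (-(x ^ 2 / (2 * σ ^ 2)))) := by
  have h1 := hF.measure_le_sum t c hσ hx hv
  have h2 := hF.measure_le_sum t (fun i => -c i) hσ hx (by
    simpa only [Complex.ofReal_neg, neg_mul, Finset.sum_neg_distrib, norm_neg] using hv)
  have hsub : {ω | x ≤ |∑ i, c i * F (t i) ω|} ⊆
      {ω | x ≤ ∑ i, c i * F (t i) ω} ∪ {ω | x ≤ ∑ i, -c i * F (t i) ω} := by
    intro ω hω
    simpa only [mem_union, mem_ofPred_eq, neg_mul, Finset.sum_neg_distrib, ← le_abs] using hω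
  refine (measure_mono hsub).trans ((measure_union_le _ _).trans ((add_le_add h1 h2).trans ?_))
  rw [← ENNReal.ofReal_add (by positivity) (by positivity), ← two_mul]

lemma integral_exp_neg_mul_sq_gaussianReal_le {b : ℝ} (hb : 0 < b) :
    ∫ x, Real.exp (-(b ^ 2 * x ^ 2 / 2)) ∂(gaussianReal 0 1) ≤ b⁻¹ := by
  rw [integral_gaussianReal_eq_integral_smul one_ne_zero]
  have hle : ∀ x : ℝ, gaussianPDFReal 0 1 x • Real.exp (-(b ^ 2 * x ^ 2 / 2)) ≤
      (√(2 * Real.pi))⁻¹ * Real.exp (-(b ^ 2 / 2) * x ^ 2) := by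
    intro x
    rw [gaussianPDFReal, smul_eq_mul]
    have h1 : Real.exp (-(x - 0) ^ 2 / (2 * ((1 : ℝ≥0) : ℝ))) ≤ 1 := by
      rw [Real.exp_le_one_iff]
      simp only [NNReal.coe_one]
      nlinarith [sq_nonneg (x - 0)]
    have h2 : -(b ^ 2 * x ^ 2 / 2) = -(b ^ 2 / 2) * x ^ 2 := by ring
    rw [h2]
    simp only [NNReal.coe_one, mul_one] at h1 ⊢
    gcongr
    exact mul_le_of_le_one_right (by positivity) h1
  have h_int := integrable_exp_neg_mul_sq (b := b ^ 2 / 2) (by positivity)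
  calc _ ≤ ∫ x, (√(2 * Real.pi))⁻¹ * Real.exp (-(b ^ 2 / 2) * x ^ 2) :=
        integral_mono_of_nonneg (Filter.Eventually.of_forall fun x => by
          have := gaussianPDFReal_nonneg 0 1 x
          simp only [Pi.zero_apply, smul_eq_mul]; positivity) (h_int.const_mul _)
          (Filter.Eventually.of_forall hle)
    _ = (√(2 * Real.pi))⁻¹ * √(Real.pi / (b ^ 2 / 2)) := by
        rw [integral_const_mul, integral_gaussian]
    _ = b⁻¹ := by
        rw [show Real.pi / (b ^ 2 / 2) = (2 * Real.pi) / b ^ 2 by field_simp,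
          Real.sqrt_div (by positivity), Real.sqrt_sq hb.le]
        have : √(2 * Real.pi) ≠ 0 := by positivity
        field_simp

lemma IsSGP.integral_exp_neg_sum_sq_le [IsProbabilityMeasure P] [IsProbabilityMeasure μ]
    (hF : IsSGP P μ F) {k : ℕ} (t : Fin k → ℝ) {κ δ : ℝ}
    (hκ : 0 < κ) (hδ : 0 < δ)
    (hlow : ∀ c : Fin k → ℝ, κ ^ 2 * ∑ i, c i ^ 2 ≤
      ∫ l, ‖∑ i, (c i : ℂ) * Complex.exp (((l * t i : ℝ) : ℂ) * Complex.I)‖ ^ 2 ∂μ) :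
    ∫ ω, Real.exp (-∑ i, (F (t i) ω / δ) ^ 2 / 2) ∂P ≤ (δ / κ) ^ k := by
  let γ : Measure (Fin k → ℝ) := Measure.pi fun _ => gaussianReal 0 1
  have hchar : ∀ ω, (∫ η, Complex.exp (((∑ i, η i * (F (t i) ω / δ) : ℝ) : ℂ) * Complex.I) ∂γ) =
      ((Real.exp (-∑ i, (F (t i) ω / δ) ^ 2 / 2) : ℝ) : ℂ) := by
    intro ω
    have h1 : ∀ η : Fin k → ℝ,
        Complex.exp (((∑ i, η i * (F (t i) ω / δ) : ℝ) : ℂ) * Complex.I) =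
        ∏ i, Complex.exp (((F (t i) ω / δ : ℝ) : ℂ) * ((η i : ℝ) : ℂ) * Complex.I) := by
      intro η
      rw [← Complex.exp_sum]
      congr 1
      push_cast
      rw [Finset.sum_mul]
      exact Finset.sum_congr rfl fun i _ => by ring
    simp_rw [h1]
    rw [integral_fintype_prod_eq_prod (𝕜 := ℂ)
      (f := fun i x => Complex.exp (((F (t i) ω / δ : ℝ) : ℂ) * ((x : ℝ) : ℂ) * Complex.I))]
    rw [← Finset.sum_neg_distrib, Real.exp_sum, Complex.ofReal_prod]
    refine Finset.prod_congr rfl fun i _ => ?_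
    rw [← charFun_apply_real, charFun_gaussianReal, Complex.ofReal_exp]
    congr 1
    push_cast
    ring
  have hY : ∀ η : Fin k → ℝ,
      (∫ ω, Complex.exp (((∑ i, η i * (F (t i) ω / δ) : ℝ) : ℂ) * Complex.I) ∂P) =
      ((Real.exp (-((∫ l, ‖∑ i, (η i : ℂ) * Complex.exp (((l * t i : ℝ) : ℂ) * Complex.I)‖ ^ 2 ∂μ)
        / (2 * δ ^ 2))) : ℝ) : ℂ) := by
    intro η
    have hmap := hF.map_eq t η
    set v := ∫ l, ‖∑ i, (η i : ℂ) * Complex.exp (((l * t i : ℝ) : ℂ) * Complex.I)‖ ^ 2 ∂μ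
    have hv0 : 0 ≤ v := integral_nonneg fun l => by positivity
    have hae : AEMeasurable (fun ω => ∑ i, η i * F (t i) ω) P :=
      Finset.aemeasurable_fun_sum _ fun i _ => (hF.aemeasurable _).const_mul _
    have h1 := charFun_gaussianReal (μ := 0) (v := v.toNNReal) (t := δ⁻¹)
    rw [← hmap, charFun_apply_real, integral_map hae (by fun_prop)] at h1
    rw [Real.coe_toNNReal _ hv0] at h1
    rw [Complex.ofReal_exp]
    have h2 : ∀ ω, Complex.exp (((∑ i, η i * (F (t i) ω / δ) : ℝ) : ℂ) * Complex.I) =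
      Complex.exp (((δ⁻¹ : ℝ) : ℂ) * ((∑ i, η i * F (t i) ω : ℝ) : ℂ) * Complex.I) := by
      intro ω
      rw [← Complex.ofReal_mul, Finset.mul_sum]
      congr 3
      exact Finset.sum_congr rfl fun i _ => by ring
    simp_rw [h2]
    rw [h1]
    congr 1
    push_cast
    field_simp
    ring
  have hswap : (∫ ω, ∫ η, Complex.exp (((∑ i, η i * (F (t i) ω / δ) : ℝ) : ℂ) * Complex.I) ∂γ ∂P) =
      ∫ η, ∫ ω, Complex.exp (((∑ i, η i * (F (t i) ω / δ) : ℝ) : ℂ) * Complex.I) ∂P ∂γ := by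
    refine integral_integral_swap ?_
    refine Integrable.of_bound (C := 1) ?_ (Filter.Eventually.of_forall fun x => ?_)
    · refine AEMeasurable.aestronglyMeasurable ?_
      refine Complex.measurable_exp.comp_aemeasurable ?_
      refine AEMeasurable.mul_const ?_ _
      refine Complex.measurable_ofReal.comp_aemeasurable ?_
      refine Finset.aemeasurable_fun_sum _ fun i _ => ?_
      refine AEMeasurable.mul ?_ ?_
      · exact ((measurable_pi_apply i).comp measurable_snd).aemeasurable
      · exact (((hF.aemeasurable (t i)).comp_fst)).div_const _
    · rw [Function.uncurry, Complex.norm_exp_ofReal_mul_I]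
  simp_rw [hchar, hY] at hswap
  rw [integral_complex_ofReal, integral_complex_ofReal, Complex.ofReal_inj] at hswap
  rw [hswap]
  have hb : 0 < κ / δ := by positivity
  have h_int_std : Integrable (fun x : ℝ => Real.exp (-((κ / δ) ^ 2 * x ^ 2 / 2))) (gaussianReal 0 1) :=
    Integrable.of_bound (C := 1) (by fun_prop) (Filter.Eventually.of_forall fun x => by
      rw [Real.norm_eq_abs, Real.abs_exp, Real.exp_le_one_iff, neg_nonpos]; positivity)
  calc _ ≤ ∫ η, ∏ i, Real.exp (-((κ / δ) ^ 2 * η i ^ 2 / 2)) ∂γ := by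
        refine integral_mono_of_nonneg (Filter.Eventually.of_forall fun η => by positivity)
          (Integrable.fintype_prod fun i => h_int_std) (Filter.Eventually.of_forall fun η => ?_)
        dsimp only
        rw [← Real.exp_sum, Real.exp_le_exp, Finset.sum_neg_distrib, neg_le_neg_iff,
          le_div_iff₀ (by positivity)]
        refine le_trans (le_of_eq ?_) (hlow η)
        rw [Finset.sum_mul, Finset.mul_sum]
        refine Finset.sum_congr rfl fun i _ => ?_
        field_simp
    _ = (∫ x, Real.exp (-((κ / δ) ^ 2 * x ^ 2 / 2)) ∂(gaussianReal 0 1)) ^ k := by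
        rw [integral_fintype_prod_eq_prod (𝕜 := ℝ)
          (f := fun i x => Real.exp (-((κ / δ) ^ 2 * x ^ 2 / 2)))]
        simp
    _ ≤ (δ / κ) ^ k := by
        refine pow_le_pow_left₀ (integral_nonneg fun x => by positivity) ?_ k
        exact (integral_exp_neg_mul_sq_gaussianReal_le hb).trans (by rw [inv_div])

lemma IsSGP.measure_forall_abs_le [IsProbabilityMeasure P] [IsProbabilityMeasure μ]
    (hF : IsSGP P μ F) {k : ℕ} (t : Fin k → ℝ) {κ δ : ℝ}
    (hκ : 0 < κ) (hδ : 0 < δ)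
    (hlow : ∀ c : Fin k → ℝ, κ ^ 2 * ∑ i, c i ^ 2 ≤
      ∫ l, ‖∑ i, (c i : ℂ) * Complex.exp (((l * t i : ℝ) : ℂ) * Complex.I)‖ ^ 2 ∂μ) :
    P {ω | ∀ i, |F (t i) ω| ≤ δ} ≤ ENNReal.ofReal ((2 * δ / κ) ^ k) := by
  have h := hF.integral_exp_neg_sum_sq_le t hκ hδ hlow
  have hae : AEMeasurable (fun ω => Real.exp (-∑ i, (F (t i) ω / δ) ^ 2 / 2)) P := by
    refine Real.measurable_exp.comp_aemeasurable (AEMeasurable.neg ?_)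
    exact Finset.aemeasurable_fun_sum _ fun i _ =>
      (((hF.aemeasurable _).div_const _).pow_const _).div_const _
  have h_int : Integrable (fun ω => Real.exp (-∑ i, (F (t i) ω / δ) ^ 2 / 2)) P :=
    Integrable.of_bound (C := 1) hae.aestronglyMeasurable (Filter.Eventually.of_forall fun x => by
      rw [Real.norm_eq_abs, Real.abs_exp, Real.exp_le_one_iff, neg_nonpos]
      exact Finset.sum_nonneg fun i _ => by positivity)
  have hmk := mul_meas_ge_le_integral_of_nonneg
    (Filter.Eventually.of_forall fun ω => (Real.exp_pos _).le) h_int (((1 : ℝ) / 2) ^ k)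
  have hsub : {ω | ∀ i, |F (t i) ω| ≤ δ} ⊆
      {ω | ((1 : ℝ) / 2) ^ k ≤ Real.exp (-∑ i, (F (t i) ω / δ) ^ 2 / 2)} := by
    intro ω hω
    simp only [mem_ofPred_eq] at hω ⊢
    have h1 : ((1 : ℝ) / 2) ^ k ≤ ∏ _i : Fin k, Real.exp (-(1 / 2)) := by
      rw [Finset.prod_const, Finset.card_univ, Fintype.card_fin]
      refine pow_le_pow_left₀ (by norm_num) ?_ k
      linarith [Real.add_one_le_exp (-(1 / 2 : ℝ))]
    refine h1.trans ?_
    rw [← Finset.sum_neg_distrib, Real.exp_sum]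
    refine Finset.prod_le_prod (fun _ _ => (Real.exp_pos _).le) fun i _ => Real.exp_le_exp.2 ?_
    have h2 : (F (t i) ω / δ) ^ 2 ≤ 1 := by
      rw [sq_le_one_iff_abs_le_one, abs_div, abs_of_pos hδ, div_le_one hδ]
      exact hω i
    linarith
  have h3 : P.real {ω | ((1 : ℝ) / 2) ^ k ≤ Real.exp (-∑ i, (F (t i) ω / δ) ^ 2 / 2)} ≤
      (2 * δ / κ) ^ k := by
    have h4 := hmk.trans h
    have h5 : (2 * δ / κ) ^ k = 2 ^ k * (δ / κ) ^ k := by rw [← mul_pow]; congr 1; ring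
    rw [h5]
    calc _ = 2 ^ k * ((1 / 2) ^ k * P.real {ω | ((1 : ℝ) / 2) ^ k ≤
              Real.exp (-∑ i, (F (t i) ω / δ) ^ 2 / 2)}) := by
            rw [← mul_assoc, ← mul_pow]; norm_num
      _ ≤ _ := by gcongr
  refine (measure_mono hsub).trans ?_
  rw [← ENNReal.ofReal_toReal (measure_ne_top P _)]
  exact ENNReal.ofReal_le_ofReal h3

end SGP

section Spectral

lemma ae_mem_msupport (μ : Measure ℝ) : ∀ᵐ l ∂μ, l ∈ msupport μ := by
  have h : μ.support = msupport μ := by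
    ext x
    exact Measure.mem_support_iff_forall x
  have := Measure.support_mem_ae (μ := μ)
  rwa [h] at this

lemma ae_sInf_le_abs (μ : Measure ℝ) :
    ∀ᵐ l ∂μ, sInf ((fun x : ℝ => abs x) '' msupport μ) ≤ |l| := by
  filter_upwards [ae_mem_msupport μ] with l hl
  refine csInf_le ⟨0, ?_⟩ (mem_image_of_mem _ hl)
  rintro _ ⟨x, -, rfl⟩
  exact abs_nonneg x

lemma exists_ae_abs_le {μ : Measure ℝ} (h : Bornology.IsBounded (msupport μ)) :
    ∃ M > (0 : ℝ), ∀ᵐ l ∂μ, |l| ≤ M := by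
  obtain ⟨M, hM0, hM⟩ := h.exists_pos_norm_le
  exact ⟨M, hM0, by filter_upwards [ae_mem_msupport μ] with l hl using hM l hl⟩

/-- A nonzero absolutely continuous part charges some set uniformly. -/
lemma exists_set_of_withDensity_rnDeriv_ne_zero {μ : Measure ℝ} [IsFiniteMeasure μ] {M : ℝ}
    (hM : ∀ᵐ l ∂μ, |l| ≤ M)
    (hac : (volume : Measure ℝ).withDensity (μ.rnDeriv volume) ≠ 0) :
    ∃ c > (0 : ℝ), ∃ S : Set ℝ, MeasurableSet S ∧ S ⊆ {l | |l| ≤ M} ∧ volume S ≠ 0 ∧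
      volume S ≠ ⊤ ∧
      ∀ A ⊆ S, MeasurableSet A → ENNReal.ofReal c * volume A ≤ μ A := by
  set f := μ.rnDeriv volume with hf
  have hfm : Measurable f := Measure.measurable_rnDeriv _ _
  have hle : (volume : Measure ℝ).withDensity f ≤ μ := Measure.withDensity_rnDeriv_le _ _
  have hI : MeasurableSet {l : ℝ | |l| ≤ M} := measurableSet_le (by fun_prop) (by fun_prop)
  have key : ∃ n : ℕ, volume ({l | ENNReal.ofReal (1 / (n + 1)) ≤ f l} ∩ {l : ℝ | |l| ≤ M}) ≠ 0 := by
    by_contra! hcon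
    apply hac
    rw [← Measure.measure_univ_eq_zero]
    have h1 : volume.withDensity f {l : ℝ | |l| ≤ M} = 0 := by
      rw [withDensity_apply _ hI, lintegral_eq_zero_iff hfm, Filter.EventuallyEq,
        ae_restrict_iff' hI]
      have h2 : volume (⋃ n : ℕ, ({l | ENNReal.ofReal (1 / (n + 1)) ≤ f l} ∩
          {l : ℝ | |l| ≤ M})) = 0 := measure_iUnion_null hcon
      rw [measure_eq_zero_iff_ae_notMem] at h2
      filter_upwards [h2] with l hl hlM
      by_contra h0
      have hpos : 0 < f l := pos_iff_ne_zero.2 h0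
      apply hl
      obtain ⟨r, hr0, hr⟩ := ENNReal.lt_iff_exists_real_btwn.1 hpos
      have hr0' : 0 < r := by simpa using hr.1
      obtain ⟨n, hn⟩ := exists_nat_one_div_lt hr0'
      exact mem_iUnion.2 ⟨n, (ENNReal.ofReal_le_ofReal hn.le).trans hr.2.le, hlM⟩
    have h3 : volume.withDensity f {l : ℝ | |l| ≤ M}ᶜ = 0 :=
      le_antisymm ((hle _).trans (le_of_eq hM)) bot_le
    rw [← union_compl_self {l : ℝ | |l| ≤ M}]
    exact measure_union_null h1 h3
  obtain ⟨n, hn⟩ := key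
  refine ⟨1 / (n + 1), by positivity, _, (measurableSet_le measurable_const hfm).inter hI,
    inter_subset_right, hn, ?_, ?_⟩
  · refine ne_top_of_le_ne_top ?_ (measure_mono inter_subset_right)
    have : {l : ℝ | |l| ≤ M} = Icc (-M) M := by
      ext l
      simp only [mem_ofPred_eq, mem_Icc, abs_le]
    rw [this]
    simp
  · intro A hA hAm
    refine le_trans ?_ (hle A)
    rw [withDensity_apply _ hAm, ← setLIntegral_const]
    exact setLIntegral_mono hfm fun l hl => (hA hl).1

lemma abs_div_four_le_abs_sin {x : ℝ} (hx : |x| ≤ Real.pi / 2 + 1 / 2) :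
    |x| / 4 ≤ |Real.sin x| := by
  wlog h0 : 0 ≤ x generalizing x
  · have := this (x := -x) (by rwa [abs_neg]) (by linarith)
    rwa [abs_neg, Real.sin_neg, abs_neg] at this
  rw [abs_of_nonneg h0] at hx ⊢
  have hp := Real.pi_gt_three
  have hp4 := Real.pi_lt_four
  refine le_trans ?_ (le_abs_self _)
  rcases le_total x (Real.pi / 2) with h | h
  · have := Real.mul_le_sin h0 h
    have h2 : (1 : ℝ) / 4 ≤ 2 / Real.pi := by
      rw [div_le_div_iff₀ (by norm_num) (by positivity)]; linarith
    nlinarith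
  · have := Real.mul_le_sin (x := Real.pi - x) (by linarith) (by linarith)
    rw [Real.sin_pi_sub] at this
    have h3 : (5 : ℝ) / 8 ≤ 2 / Real.pi * (Real.pi - x) := by
      have h315 := Real.pi_lt_d2
      rw [div_mul_eq_mul_div, div_le_div_iff₀ (by norm_num) (by positivity)]
      nlinarith
    have h315 := Real.pi_lt_d2
    linarith

lemma exists_mul_abs_sub_le_norm_exp_sub (z : ℂ) : ∃ a : ℝ, ∀ x : ℝ, |x| ≤ 1 / 2 →
    max 1 ‖z‖ * (|x - a| / 8) ≤ ‖Complex.exp ((x : ℂ) * Complex.I) - z‖ := by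
  have hsin : ∀ x : ℝ, max 1 ‖z‖ * (|Real.sin (x - z.arg)| / 2) ≤
      ‖Complex.exp ((x : ℂ) * Complex.I) - z‖ := by
    intro x
    have hz : z = (‖z‖ : ℂ) * Complex.exp (z.arg * Complex.I) :=
      (Complex.norm_mul_exp_arg_mul_I z).symm
    have h1 : ‖Complex.exp ((x : ℂ) * Complex.I) - z‖ =
        ‖Complex.exp (((x - z.arg : ℝ) : ℂ) * Complex.I) - (‖z‖ : ℂ)‖ := by
      have : Complex.exp ((x : ℂ) * Complex.I) - z =
          Complex.exp (z.arg * Complex.I) *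
            (Complex.exp (((x - z.arg : ℝ) : ℂ) * Complex.I) - (‖z‖ : ℂ)) := by
        have h0 : Complex.exp (z.arg * Complex.I) *
            Complex.exp (((x - z.arg : ℝ) : ℂ) * Complex.I) =
            Complex.exp ((x : ℂ) * Complex.I) := by
          rw [← Complex.exp_add]
          congr 1
          push_cast
          ring
        rw [mul_sub, h0, mul_comm _ (‖z‖ : ℂ), ← hz]
      rw [this, norm_mul, Complex.norm_exp_ofReal_mul_I, one_mul]
    rw [h1]
    have h2 : |Real.sin (x - z.arg)| ≤
        ‖Complex.exp (((x - z.arg : ℝ) : ℂ) * Complex.I) - (‖z‖ : ℂ)‖ := by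
      have := Complex.abs_im_le_norm
        (Complex.exp (((x - z.arg : ℝ) : ℂ) * Complex.I) - (‖z‖ : ℂ))
      rwa [Complex.sub_im, Complex.exp_ofReal_mul_I_im, Complex.ofReal_im, sub_zero] at this
    have h3 : ‖z‖ - 1 ≤ ‖Complex.exp (((x - z.arg : ℝ) : ℂ) * Complex.I) - (‖z‖ : ℂ)‖ := by
      have := norm_sub_norm_le (‖z‖ : ℂ) (Complex.exp (((x - z.arg : ℝ) : ℂ) * Complex.I))
      rwa [Complex.norm_exp_ofReal_mul_I, Complex.norm_real, norm_norm, norm_sub_rev] at this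
    have h4 := Real.abs_sin_le_one (x - z.arg)
    have h5 := abs_nonneg (Real.sin (x - z.arg))
    rcases le_total ‖z‖ 2 with h | h
    · have : max 1 ‖z‖ ≤ 2 := max_le (by norm_num) h
      nlinarith
    · rw [max_eq_right (by linarith)]
      nlinarith
  have hred : ∃ a : ℝ, |a| ≤ Real.pi / 2 ∧ ∀ x, |Real.sin (x - z.arg)| = |Real.sin (x - a)| := by
    have h1 := Complex.neg_pi_lt_arg z
    have h2 := Complex.arg_le_pi z
    rcases le_or_gt z.arg (Real.pi / 2) with h | h
    · rcases le_or_gt (-(Real.pi / 2)) z.arg with h' | h'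
      · exact ⟨z.arg, abs_le.2 ⟨h', h⟩, fun x => rfl⟩
      · refine ⟨z.arg + Real.pi, abs_le.2 ⟨by linarith, by linarith⟩, fun x => ?_⟩
        rw [← sub_sub, Real.sin_sub_pi, abs_neg]
    · refine ⟨z.arg - Real.pi, abs_le.2 ⟨by linarith, by linarith⟩, fun x => ?_⟩
      rw [← sub_add, Real.sin_add_pi, abs_neg]
  obtain ⟨a, ha, hax⟩ := hred
  refine ⟨a, fun x hx => le_trans ?_ (hsin x)⟩
  rw [hax]
  have h6 : |x - a| / 4 ≤ |Real.sin (x - a)| :=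
    abs_div_four_le_abs_sin (by
      rw [abs_le] at *
      constructor <;> linarith)
  have h7 : |x - a| / 8 ≤ |Real.sin (x - a)| / 2 := by linarith
  gcongr

lemma lintegral_abs_rpow_lt_top :
    ∫⁻ u in Icc (-1 : ℝ) 1, ENNReal.ofReal (|u| ^ (-(1 / 2) : ℝ)) < ⊤ := by
  have h1 : IntegrableOn (fun u : ℝ => |u| ^ (-(1 / 2) : ℝ)) (Ioc 0 1) := by
    have := intervalIntegral.intervalIntegrable_rpow' (a := 0) (b := 1) (r := -(1 / 2)) (by norm_num)
    rw [intervalIntegrable_iff_integrableOn_Ioc_of_le zero_le_one] at this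
    exact this.congr_fun (fun u hu => by simp only [abs_of_pos hu.1]) measurableSet_Ioc
  have h2 : IntervalIntegrable (fun u : ℝ => |u| ^ (-(1 / 2) : ℝ)) volume 0 1 :=
    (intervalIntegrable_iff_integrableOn_Ioc_of_le zero_le_one).2 h1
  have h3 : IntervalIntegrable (fun u : ℝ => |u| ^ (-(1 / 2) : ℝ)) volume (-1) 0 := by
    have := (IntervalIntegrable.iff_comp_neg (f := fun u : ℝ => |u| ^ (-(1 / 2) : ℝ))
      (a := 0) (b := 1)).1 h2
    simpa [abs_neg] using this.symm
  have h4 := (intervalIntegrable_iff_integrableOn_Icc_of_le (by norm_num)).1 (h3.trans h2)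
  have h5 := h4.hasFiniteIntegral
  rw [hasFiniteIntegral_iff_enorm] at h5
  refine lt_of_le_of_lt (lintegral_mono fun u => ?_) h5
  rw [← ofReal_norm]
  exact ENNReal.ofReal_le_ofReal (Real.le_norm_self _)

lemma setLIntegral_abs_sub_rpow_le (S : Set ℝ) (a : ℝ) :
    ∫⁻ u in S, ENNReal.ofReal (|u - a| ^ (-(1 / 2) : ℝ)) ≤
      volume S + ∫⁻ u in Icc (-1 : ℝ) 1, ENNReal.ofReal (|u| ^ (-(1 / 2) : ℝ)) := by
  have h1 : ∀ u : ℝ, ENNReal.ofReal (|u - a| ^ (-(1 / 2) : ℝ)) ≤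
      1 + (Icc (-1 : ℝ) 1).indicator (fun v => ENNReal.ofReal (|v| ^ (-(1 / 2) : ℝ))) (u - a) := by
    intro u
    by_cases hu : u - a ∈ Icc (-1 : ℝ) 1
    · rw [indicator_of_mem hu]
      exact le_add_self
    · rw [indicator_of_notMem hu, add_zero, ENNReal.ofReal_le_one]
      refine Real.rpow_le_one_of_one_le_of_nonpos ?_ (by norm_num)
      by_contra! h
      exact hu (abs_le.1 h.le)
  calc _ ≤ ∫⁻ u in S, (1 + (Icc (-1 : ℝ) 1).indicator
        (fun v => ENNReal.ofReal (|v| ^ (-(1 / 2) : ℝ))) (u - a)) := lintegral_mono h1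
    _ = volume S + ∫⁻ u in S, (Icc (-1 : ℝ) 1).indicator
        (fun v => ENNReal.ofReal (|v| ^ (-(1 / 2) : ℝ))) (u - a) := by
        rw [lintegral_add_left measurable_const]
        simp
    _ ≤ volume S + ∫⁻ u, (Icc (-1 : ℝ) 1).indicator
        (fun v => ENNReal.ofReal (|v| ^ (-(1 / 2) : ℝ))) (u - a) := by
        gcongr
        exact Measure.restrict_le_self
    _ = _ := by
        rw [lintegral_sub_right_eq_self, lintegral_indicator measurableSet_Icc]

lemma multiset_prod_le_exp_sum (m : Multiset ℝ) (h : ∀ x ∈ m, 0 ≤ x) :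
    m.prod ≤ Real.exp m.sum := by
  induction m using Multiset.induction_on with
  | empty => simp
  | cons x m ih =>
    rw [Multiset.prod_cons, Multiset.sum_cons, Real.exp_add]
    have hx : 0 ≤ x := h x (Multiset.mem_cons_self _ _)
    have hm := ih fun y hy => h y (Multiset.mem_cons_of_mem hy)
    have h1 : x ≤ Real.exp x := by linarith [Real.add_one_le_exp x]
    have h0 : 0 ≤ m.prod :=
      Multiset.prod_nonneg fun y hy => h y (Multiset.mem_cons_of_mem hy)
    gcongr

lemma setLIntegral_multiset_sum_le (S : Set ℝ) (a : ℂ → ℝ) (m : Multiset ℂ) :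
    Measurable (fun u : ℝ => (m.map fun z => ENNReal.ofReal (|u - a z| ^ (-(1 / 2) : ℝ))).sum) ∧
    ∫⁻ u in S, (m.map fun z => ENNReal.ofReal (|u - a z| ^ (-(1 / 2) : ℝ))).sum ≤
      Multiset.card m *
        (volume S + ∫⁻ u in Icc (-1 : ℝ) 1, ENNReal.ofReal (|u| ^ (-(1 / 2) : ℝ))) := by
  induction m using Multiset.induction_on with
  | empty => simp
  | cons z m ih =>
    have hm : Measurable fun u : ℝ => ENNReal.ofReal (|u - a z| ^ (-(1 / 2) : ℝ)) := by fun_prop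
    simp only [Multiset.map_cons, Multiset.sum_cons, Multiset.card_cons]
    refine ⟨hm.add ih.1, ?_⟩
    rw [lintegral_add_left hm]
    push_cast
    rw [add_mul, one_mul, add_comm]
    exact add_le_add ih.2 (setLIntegral_abs_sub_rpow_le S (a z))

lemma exp_neg_two_mul_sum_le_prod (u : ℝ) (a : ℂ → ℝ) (m : Multiset ℂ) {R : ℝ} (hR : 0 ≤ R)
    (hne : ∀ z ∈ m, u ≠ a z)
    (h : (m.map fun z => ENNReal.ofReal (|u - a z| ^ (-(1 / 2) : ℝ))).sum ≤ ENNReal.ofReal R) :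
    Real.exp (-(2 * R)) ≤ (m.map fun z => |u - a z|).prod := by
  have hsum : (m.map fun z => ENNReal.ofReal (|u - a z| ^ (-(1 / 2) : ℝ))).sum =
      ENNReal.ofReal (m.map fun z => |u - a z| ^ (-(1 / 2) : ℝ)).sum := by
    clear h hne
    induction m using Multiset.induction_on with
    | empty => simp
    | cons z m ih =>
      simp only [Multiset.map_cons, Multiset.sum_cons]
      rw [ih, ENNReal.ofReal_add (by positivity)]
      refine Multiset.sum_nonneg fun x hx => ?_
      obtain ⟨w, -, rfl⟩ := Multiset.mem_map.1 hx
      positivity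
  rw [hsum, ENNReal.ofReal_le_ofReal_iff hR] at h
  have h1 := multiset_prod_le_exp_sum (m.map fun z => |u - a z| ^ (-(1 / 2) : ℝ)) fun x hx => by
    obtain ⟨w, -, rfl⟩ := Multiset.mem_map.1 hx
    positivity
  have h2 : (m.map fun z => |u - a z| ^ (-(1 / 2) : ℝ)).prod ^ 2 *
      (m.map fun z => |u - a z|).prod = 1 := by
    clear h hsum h1
    induction m using Multiset.induction_on with
    | empty => simp
    | cons z m ih =>
      simp only [Multiset.map_cons, Multiset.prod_cons]
      have hz : 0 < |u - a z| :=
        abs_pos.2 (sub_ne_zero.2 (hne z (Multiset.mem_cons_self _ _)))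
      have h3 : (|u - a z| ^ (-(1 / 2) : ℝ)) ^ 2 * |u - a z| = 1 := by
        rw [← Real.rpow_natCast, ← Real.rpow_mul hz.le]
        norm_num
        rw [Real.rpow_neg_one, inv_mul_cancel₀ hz.ne']
      have h4 := ih fun w hw => hne w (Multiset.mem_cons_of_mem hw)
      calc _ = ((|u - a z| ^ (-(1 / 2) : ℝ)) ^ 2 * |u - a z|) *
            ((m.map fun z => |u - a z| ^ (-(1 / 2) : ℝ)).prod ^ 2 *
              (m.map fun z => |u - a z|).prod) := by ring
        _ = 1 := by rw [h3, h4, one_mul]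
  have h0 : 0 ≤ (m.map fun z => |u - a z| ^ (-(1 / 2) : ℝ)).prod := by
    refine Multiset.prod_nonneg fun x hx => ?_
    obtain ⟨w, -, rfl⟩ := Multiset.mem_map.1 hx
    positivity
  have hq : 0 ≤ (m.map fun z => |u - a z|).prod := by
    refine Multiset.prod_nonneg fun x hx => ?_
    obtain ⟨w, -, rfl⟩ := Multiset.mem_map.1 hx
    positivity
  have h5 : (m.map fun z => |u - a z| ^ (-(1 / 2) : ℝ)).prod ^ 2 ≤ Real.exp (2 * R) := by
    have : Real.exp (2 * R) = Real.exp R ^ 2 := by rw [← Real.exp_nat_mul]; norm_num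
    rw [this]
    exact pow_le_pow_left₀ h0 (h1.trans (Real.exp_le_exp.2 h)) 2
  rw [Real.exp_neg, inv_le_iff_one_le_mul₀ (Real.exp_pos _)]
  calc (1 : ℝ) = _ := h2.symm
    _ ≤ Real.exp (2 * R) * _ := by gcongr
    _ = _ := mul_comm _ _

end Spectral

section SpectralLowerBound

open Polynomial in
lemma mahlerMeasure_mul_le_norm_eval (p : ℂ[X]) (w : ℂ) {s : ℝ} (hs : 0 ≤ s) (f : ℂ → ℝ)
    (hf : ∀ z, 0 ≤ f z) (h : ∀ z ∈ p.roots, max 1 ‖z‖ * (s * f z) ≤ ‖w - z‖) :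
    p.mahlerMeasure * (s ^ p.natDegree * (p.roots.map f).prod) ≤ ‖p.eval w‖ := by
  have hcard : p.roots.card = p.natDegree := IsAlgClosed.card_roots_eq_natDegree
  rw [mahlerMeasure_eq_leadingCoeff_mul_prod_roots, (IsAlgClosed.splits p).eval_eq_prod_roots,
    norm_mul, mul_assoc]
  refine mul_le_mul_of_nonneg_left ?_ (norm_nonneg _)
  have h1 : s ^ p.natDegree * (p.roots.map f).prod = (p.roots.map fun z => s * f z).prod := by
    rw [Multiset.prod_map_mul, Multiset.map_const', Multiset.prod_replicate, hcard]
  have h2 : ‖(p.roots.map fun z => w - z).prod‖ = (p.roots.map fun z => ‖w - z‖).prod := by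
    have := map_multiset_prod (normHom : ℂ →*₀ ℝ) (p.roots.map fun z => w - z)
    rwa [Multiset.map_map] at this
  rw [h1, ← Multiset.prod_map_mul, h2]
  exact Multiset.prod_map_le_prod_map₀ _ _
    (fun z _ => mul_nonneg (by positivity) (mul_nonneg hs (hf z))) h

open Polynomial in
lemma exists_pow_mul_sq_coeff_le_integral {μ : Measure ℝ} [IsProbabilityMeasure μ] {M h : ℝ}
    (hM : ∀ᵐ l ∂μ, |l| ≤ M)
    (hac : (volume : Measure ℝ).withDensity (μ.rnDeriv volume) ≠ 0)
    (h0 : 0 < h) (h1 : h ≤ 1) (hMh : h * M ≤ 1 / 2) :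
    ∃ κ > (0 : ℝ), κ ≤ 1 ∧ ∀ (K : ℕ) (p : ℂ[X]), p.natDegree ≤ K → ∀ i,
      κ ^ (K + 1) * ‖p.coeff i‖ ^ 2 ≤
        ∫ l, ‖p.eval (Complex.exp (((h * l : ℝ) : ℂ) * Complex.I))‖ ^ 2 ∂μ := by
  obtain ⟨c0, hc0, S, hSm, hSM, hS0, hStop, hS⟩ :=
    exists_set_of_withDensity_rnDeriv_ne_zero hM hac
  set v := (volume S).toReal with hv
  have hv0 : 0 < v := ENNReal.toReal_pos hS0 hStop
  set I0 := ∫⁻ u in Icc (-1 : ℝ) 1, ENNReal.ofReal (|u| ^ (-(1 / 2) : ℝ)) with hI0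
  have hCtop : volume S + I0 ≠ ⊤ := ENNReal.add_ne_top.2 ⟨hStop, lintegral_abs_rpow_lt_top.ne⟩
  set C0 := (volume S + I0).toReal with hC0
  have hC00 : 0 < C0 := ENNReal.toReal_pos (by simp [hS0]) hCtop
  set A := 2 * C0 / v with hA
  have hA0 : 0 < A := by positivity
  choose a ha using exists_mul_abs_sub_le_norm_exp_sub
  refine ⟨min 1 (c0 * (v / 2)) * ((h / 16) ^ 2 * Real.exp (-(4 * A))), by positivity, ?_, ?_⟩
  · refine mul_le_one₀ (min_le_left _ _) (by positivity) (mul_le_one₀ ?_ (by positivity) ?_)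
    · exact pow_le_one₀ (by positivity) (by linarith)
    · rw [Real.exp_le_one_iff]
      linarith
  intro K p hpK i
  set D := p.natDegree with hD
  set R := A * (D + 1) with hR
  have hR0 : 0 < R := by positivity
  set G : ℝ → ℝ≥0∞ := fun u =>
    (p.roots.map fun z => ENNReal.ofReal (|u - a z / h| ^ (-(1 / 2) : ℝ))).sum with hG
  obtain ⟨hGm, hGint⟩ := setLIntegral_multiset_sum_le S (fun z => a z / h) p.roots
  rw [IsAlgClosed.card_roots_eq_natDegree] at hGint
  set Z : Set ℝ := (fun z => a z / h) '' (p.roots.toFinset : Set ℂ) with hZ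
  have hZfin : Z.Finite := (Finset.finite_toSet _).image _
  set S' := (S ∩ {u | G u ≤ ENNReal.ofReal R}) \ Z with hS'
  have hS'm : MeasurableSet S' :=
    (hSm.inter (measurableSet_le hGm measurable_const)).diff hZfin.measurableSet
  have hbad : volume (S ∩ {u | ENNReal.ofReal R ≤ G u}) ≤ ENNReal.ofReal (v / 2) := by
    have h2 := meas_ge_le_lintegral_div (μ := volume.restrict S) hGm.aemeasurable
      (ε := ENNReal.ofReal R) (by simpa using hR0) (by simp)
    rw [Measure.restrict_apply (measurableSet_le measurable_const hGm), inter_comm] at h2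
    refine h2.trans ((ENNReal.div_le_div_right hGint _).trans ?_)
    rw [← ENNReal.ofReal_toReal hCtop, ← ENNReal.ofReal_natCast, ← ENNReal.ofReal_mul (by positivity),
      ← ENNReal.ofReal_div_of_pos hR0]
    refine ENNReal.ofReal_le_ofReal ?_
    rw [div_le_iff₀ hR0, ← hC0]
    have h3 : v / 2 * R = C0 * (D + 1) := by
      rw [hR, hA]
      field_simp
    rw [h3]
    nlinarith
  have hS'v : ENNReal.ofReal (v / 2) ≤ volume S' := by
    have h2 : volume S ≤ volume S' + ENNReal.ofReal (v / 2) := by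
      have h3 : S ⊆ S' ∪ ((S ∩ {u | ENNReal.ofReal R ≤ G u}) ∪ Z) := by
        intro u hu
        by_cases hz : u ∈ Z
        · exact Or.inr (Or.inr hz)
        rcases le_total (G u) (ENNReal.ofReal R) with h4 | h4
        · exact Or.inl ⟨⟨hu, h4⟩, hz⟩
        · exact Or.inr (Or.inl ⟨hu, h4⟩)
      refine (measure_mono h3).trans ((measure_union_le _ _).trans ?_)
      gcongr
      refine (measure_union_le _ _).trans ?_
      rw [hZfin.measure_zero, add_zero]
      exact hbad
    rw [← ENNReal.ofReal_toReal hStop, ← hv] at h2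
    have h3 : ENNReal.ofReal v = ENNReal.ofReal (v / 2) + ENNReal.ofReal (v / 2) := by
      rw [← ENNReal.ofReal_add (by positivity) (by positivity), add_halves]
    rw [h3] at h2
    exact (ENNReal.add_le_add_iff_right ENNReal.ofReal_ne_top).1 h2
  set f : ℝ → ℝ := fun l => ‖p.eval (Complex.exp (((h * l : ℝ) : ℂ) * Complex.I))‖ ^ 2 with hf
  set e := (p.mahlerMeasure * ((h / 8) ^ D * Real.exp (-(2 * R)))) ^ 2 with he
  have hpt : ∀ u ∈ S', e ≤ f u := by
    rintro u ⟨⟨huS, huG⟩, huZ⟩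
    have h2 := exp_neg_two_mul_sum_le_prod u (fun z => a z / h) p.roots hR0.le
      (fun z hz hu => huZ ⟨z, by simpa using hz, hu.symm⟩) huG
    have h3 := mahlerMeasure_mul_le_norm_eval p
      (Complex.exp (((h * u : ℝ) : ℂ) * Complex.I)) (s := h / 8) (by positivity)
      (fun z => |u - a z / h|) (fun z => abs_nonneg _) (fun z _ => by
        refine le_trans (le_of_eq ?_) (ha z (h * u) ?_)
        · congr 1
          have : h * u - a z = h * (u - a z / h) := by field_simp
          rw [this, abs_mul, abs_of_pos h0]
          ring
        · rw [abs_mul, abs_of_pos h0]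
          have := hSM huS
          simp only [mem_ofPred_eq] at this
          nlinarith)
    refine pow_le_pow_left₀ (mul_nonneg (mahlerMeasure_nonneg _) (by positivity))
      (le_trans ?_ h3) 2
    refine mul_le_mul_of_nonneg_left ?_ (mahlerMeasure_nonneg _)
    gcongr
  have hfc : Continuous f := by
    simp only [hf]
    fun_prop
  have hfb : ∃ C, ∀ l, ‖f l‖ ≤ C := by
    refine ⟨(∑ j ∈ Finset.range (p.natDegree + 1), ‖p.coeff j‖) ^ 2, fun l => ?_⟩
    rw [Real.norm_of_nonneg (by positivity)]
    refine pow_le_pow_left₀ (norm_nonneg _) ?_ 2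
    rw [eval_eq_sum_range]
    refine norm_sum_le_of_le _ fun j _ => ?_
    rw [norm_mul, norm_pow, Complex.norm_exp_ofReal_mul_I, one_pow, mul_one]
  obtain ⟨Cb, hCb⟩ := hfb
  have hfi : Integrable f μ :=
    Integrable.of_bound hfc.aestronglyMeasurable Cb (Filter.Eventually.of_forall hCb)
  have hmark := mul_meas_ge_le_integral_of_nonneg
    (Filter.Eventually.of_forall fun l => by simp only [hf]; positivity) hfi e
  have hμ : c0 * (v / 2) ≤ μ.real {x | e ≤ f x} := by
    have h2 := hS S' (fun u hu => hu.1.1) hS'm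
    have h3 : ENNReal.ofReal (c0 * (v / 2)) ≤ μ {x | e ≤ f x} := by
      rw [ENNReal.ofReal_mul hc0.le]
      exact (mul_le_mul_right hS'v _).trans (h2.trans (measure_mono hpt))
    exact (ENNReal.ofReal_le_iff_le_toReal (measure_ne_top _ _)).1 h3
  have hcoef : ‖p.coeff i‖ ≤ 2 ^ D * p.mahlerMeasure := by
    refine (norm_coeff_le_choose_mul_mahlerMeasure i p).trans ?_
    refine mul_le_mul_of_nonneg_right ?_ (mahlerMeasure_nonneg _)
    exact_mod_cast Nat.choose_le_two_pow _ _
  set κ₀ := min 1 (c0 * (v / 2)) * ((h / 16) ^ 2 * Real.exp (-(4 * A))) with hκ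
  have hκ1 : κ₀ ≤ 1 := by
    refine mul_le_one₀ (min_le_left _ _) (by positivity) (mul_le_one₀ ?_ (by positivity) ?_)
    · exact pow_le_one₀ (by positivity) (by linarith)
    · rw [Real.exp_le_one_iff]
      linarith
  have hκD : κ₀ ^ (K + 1) ≤ c0 * (v / 2) * ((h / 16) ^ (2 * D) * Real.exp (-(4 * R))) := by
    calc κ₀ ^ (K + 1) ≤ κ₀ ^ (D + 1) := pow_le_pow_of_le_one (by positivity) hκ1 (by omega)
      _ = min 1 (c0 * (v / 2)) ^ (D + 1) *
          ((h / 16) ^ (2 * (D + 1)) * Real.exp (-(4 * R))) := by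
          rw [hκ, mul_pow, mul_pow, ← pow_mul, ← Real.exp_nat_mul, hR]
          congr 3
          push_cast
          ring
      _ ≤ _ := by
          gcongr ?_ * (?_ * _)
          · calc min 1 (c0 * (v / 2)) ^ (D + 1) ≤ min 1 (c0 * (v / 2)) ^ 1 :=
                pow_le_pow_of_le_one (by positivity) (min_le_left _ _) (by omega)
              _ ≤ _ := by rw [pow_one]; exact min_le_right _ _
          · exact pow_le_pow_of_le_one (by positivity) (by linarith) (by omega)
  calc κ₀ ^ (K + 1) * ‖p.coeff i‖ ^ 2
      ≤ c0 * (v / 2) * ((h / 16) ^ (2 * D) * Real.exp (-(4 * R))) *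
        (2 ^ D * p.mahlerMeasure) ^ 2 := by
        gcongr
    _ = e * (c0 * (v / 2)) := by
        rw [he]
        have e1 : Real.exp (-(4 * R)) = Real.exp (-(2 * R)) ^ 2 := by
          rw [← Real.exp_nat_mul]
          congr 1
          push_cast
          ring
        have e2 : (h / 8) ^ D = (h / 16) ^ D * 2 ^ D := by
          rw [← mul_pow]
          congr 1
          ring
        rw [e1, e2, pow_mul']
        ring
    _ ≤ e * μ.real {x | e ≤ f x} := by
        gcongr
    _ ≤ _ := hmark

/-- The spectral lower bound for trigonometric sums along an arithmetic progression. -/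
lemma exists_pow_mul_sum_sq_le_integral {μ : Measure ℝ} [IsProbabilityMeasure μ] {M h : ℝ}
    (hM : ∀ᵐ l ∂μ, |l| ≤ M)
    (hac : (volume : Measure ℝ).withDensity (μ.rnDeriv volume) ≠ 0)
    (h0 : 0 < h) (h1 : h ≤ 1) (hMh : h * M ≤ 1 / 2) :
    ∃ κ > (0 : ℝ), κ ≤ 1 ∧ ∀ (K k j₀ : ℕ) (e : Fin k → ℕ), Function.Injective e →
      (∀ i, e i ≤ K) → ∀ c : Fin k → ℝ,
      (κ ^ (K + 1)) ^ 2 * ∑ i, c i ^ 2 ≤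
        ∫ l, ‖∑ i, (c i : ℂ) *
          Complex.exp (((l * (((j₀ + e i : ℕ) : ℝ) * h) : ℝ) : ℂ) * Complex.I)‖ ^ 2 ∂μ := by
  classical
  obtain ⟨κ, hκ0, hκ1, hκ⟩ := exists_pow_mul_sq_coeff_le_integral hM hac h0 h1 hMh
  refine ⟨κ / 2, by positivity, by linarith, fun K k j₀ e he heK c => ?_⟩
  set p : Polynomial ℂ := ∑ i, Polynomial.monomial (e i) (c i : ℂ) with hp
  have hdeg : p.natDegree ≤ K :=
    Polynomial.natDegree_sum_le_of_forall_le _ _ fun i _ =>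
      (Polynomial.natDegree_monomial_le _).trans (heK i)
  have hcoef : ∀ i, p.coeff (e i) = c i := by
    intro i
    rw [hp, Polynomial.finsetSum_coeff, Finset.sum_eq_single i]
    · rw [Polynomial.coeff_monomial, if_pos rfl]
    · intro j _ hj
      rw [Polynomial.coeff_monomial, if_neg fun h => hj (he h)]
    · simp
  have heval : ∀ l : ℝ, ‖∑ i, (c i : ℂ) *
      Complex.exp (((l * (((j₀ + e i : ℕ) : ℝ) * h) : ℝ) : ℂ) * Complex.I)‖ =
      ‖p.eval (Complex.exp (((h * l : ℝ) : ℂ) * Complex.I))‖ := by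
    intro l
    have h2 : ∑ i, (c i : ℂ) *
        Complex.exp (((l * (((j₀ + e i : ℕ) : ℝ) * h) : ℝ) : ℂ) * Complex.I) =
        Complex.exp (((l * (j₀ * h) : ℝ) : ℂ) * Complex.I) *
          p.eval (Complex.exp (((h * l : ℝ) : ℂ) * Complex.I)) := by
      rw [hp, Polynomial.eval_finsetSum, Finset.mul_sum]
      refine Finset.sum_congr rfl fun i _ => ?_
      rw [Polynomial.eval_monomial, ← Complex.exp_nat_mul, mul_left_comm (Complex.exp _),
        ← Complex.exp_add]
      congr 2
      push_cast
      ring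
    rw [h2, norm_mul, Complex.norm_exp_ofReal_mul_I, one_mul]
  simp_rw [heval]
  set V := ∫ l, ‖p.eval (Complex.exp (((h * l : ℝ) : ℂ) * Complex.I))‖ ^ 2 ∂μ with hV
  have hci : ∀ i, κ ^ (K + 1) * c i ^ 2 ≤ V := by
    intro i
    have := hκ K p hdeg (e i)
    rwa [hcoef, Complex.norm_real, Real.norm_eq_abs, sq_abs] at this
  have hk : k ≤ K + 1 := by
    have : Function.Injective fun i => (⟨e i, Nat.lt_succ_of_le (heK i)⟩ : Fin (K + 1)) :=
      fun i j hij => he (by simpa using hij)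
    simpa using Fintype.card_le_of_injective _ this
  have hV0 : 0 ≤ V := integral_nonneg fun l => by positivity
  have hsum : κ ^ (K + 1) * ∑ i, c i ^ 2 ≤ (K + 1) * V := by
    rw [Finset.mul_sum]
    refine (Finset.sum_le_sum fun i _ => hci i).trans ?_
    rw [Finset.sum_const, Finset.card_univ, Fintype.card_fin, nsmul_eq_mul]
    have : (k : ℝ) ≤ K + 1 := by exact_mod_cast hk
    gcongr
  have h2 : (K + 1 : ℝ) ≤ 2 ^ (K + 1) := by
    exact_mod_cast (Nat.lt_two_pow_self (n := K + 1)).le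
  have h3 : κ ^ (K + 1) ≤ 1 := pow_le_one₀ hκ0.le hκ1
  have h5 : 0 ≤ ∑ i, c i ^ 2 := Finset.sum_nonneg fun i _ => sq_nonneg _
  have h6 : (2 : ℝ) ^ (K + 1) ≤ (2 ^ (K + 1)) ^ 2 := by
    have : (1 : ℝ) ≤ 2 ^ (K + 1) := one_le_pow₀ (by norm_num)
    nlinarith
  rw [div_pow, div_pow, div_mul_eq_mul_div, div_le_iff₀ (by positivity)]
  calc (κ ^ (K + 1)) ^ 2 * ∑ i, c i ^ 2
      = κ ^ (K + 1) * (κ ^ (K + 1) * ∑ i, c i ^ 2) := by ring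
    _ ≤ 1 * (κ ^ (K + 1) * ∑ i, c i ^ 2) := by gcongr
    _ ≤ (K + 1) * V := by rw [one_mul]; exact hsum
    _ ≤ (2 ^ (K + 1)) ^ 2 * V := by gcongr; exact h2.trans h6
    _ = _ := mul_comm _ _

end SpectralLowerBound

section Window

open Polynomial in
lemma coeff_pow_nonneg {f : ℝ[X]} (hf : ∀ i, 0 ≤ f.coeff i) (p : ℕ) : ∀ i, 0 ≤ (f ^ p).coeff i := by
  induction p with
  | zero =>
    intro i
    rw [pow_zero, coeff_one]
    split_ifs <;> norm_num
  | succ p ih =>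
    intro i
    rw [pow_succ, coeff_mul]
    exact Finset.sum_nonneg fun x _ => mul_nonneg (ih _) (hf _)

lemma norm_sum_range_pow_le {z : ℂ} (hz : ‖z‖ = 1) (N : ℕ) :
    ‖∑ i ∈ Finset.range N, z ^ i‖ ≤ N := by
  refine (norm_sum_le_of_le _ fun i _ => (by rw [norm_pow, hz, one_pow] : ‖z ^ i‖ ≤ 1)).trans ?_
  simp

lemma norm_sum_range_pow_le_div {z : ℂ} (hz : ‖z‖ = 1) (hz1 : z ≠ 1) (N : ℕ) :
    ‖∑ i ∈ Finset.range N, z ^ i‖ ≤ 2 / ‖z - 1‖ := by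
  rw [geom_sum_eq hz1, norm_div]
  gcongr
  refine (norm_sub_le _ _).trans ?_
  rw [norm_pow, hz, one_pow, norm_one]
  norm_num

open Polynomial in
/-- A cutoff that equals one away from a collar of length `m` and whose exponential sums decay
geometrically away from zero frequency. -/
lemma exists_window {N m n r p : ℕ} (hr : 0 < r) (hpr : p * r ≤ m) (hN : 0 < N) (hn : n = N + m) :
    ∃ w : ℕ → ℝ, (∀ j, 0 ≤ w j) ∧ (∀ j, w j ≤ 1) ∧ (∀ j, m ≤ j → j < N → w j = 1) ∧
      ∀ z : ℂ, ‖z‖ = 1 → z ≠ 1 →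
        ‖∑ j ∈ Finset.range n, (w j : ℂ) * z ^ j‖ ≤ N * (2 / (r * ‖z - 1‖)) ^ p := by
  have hr' : (0 : ℝ) < r := by exact_mod_cast hr
  set f : ℝ[X] := C (1 / (r : ℝ)) * ∑ i ∈ Finset.range r, X ^ i with hf
  set Q : ℝ[X] := f ^ p with hQ
  set W : ℝ[X] := (∑ i ∈ Finset.range N, X ^ i) * Q with hW
  have hfdeg : f.natDegree ≤ r - 1 := by
    refine (natDegree_C_mul_le _ _).trans (natDegree_sum_le_of_forall_le _ _ fun i hi => ?_)
    rw [natDegree_X_pow]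
    have := Finset.mem_range.1 hi
    omega
  have hQdeg : Q.natDegree ≤ p * (r - 1) := natDegree_pow_le.trans (Nat.mul_le_mul_left _ hfdeg)
  have hQm : Q.natDegree ≤ m := hQdeg.trans ((Nat.mul_le_mul_left _ (Nat.sub_le _ _)).trans hpr)
  have hWdeg : W.natDegree < n := by
    have h1 : (∑ i ∈ Finset.range N, X ^ i : ℝ[X]).natDegree ≤ N - 1 := by
      refine natDegree_sum_le_of_forall_le _ _ fun i hi => ?_
      rw [natDegree_X_pow]
      have := Finset.mem_range.1 hi
      omega
    have h2 := natDegree_mul_le (p := (∑ i ∈ Finset.range N, X ^ i : ℝ[X])) (q := Q)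
    rw [← hW] at h2
    omega
  have hfnn : ∀ i, 0 ≤ f.coeff i := by
    intro i
    rw [hf, coeff_C_mul, finsetSum_coeff]
    refine mul_nonneg (by positivity) (Finset.sum_nonneg fun j _ => ?_)
    rw [coeff_X_pow]
    split_ifs <;> norm_num
  have hQnn : ∀ i, 0 ≤ Q.coeff i := coeff_pow_nonneg hfnn p
  have hQ1 : Q.eval 1 = 1 := by
    rw [hQ, hf, eval_pow, eval_mul, eval_C, eval_finsetSum]
    simp only [eval_pow, eval_X, one_pow, Finset.sum_const, Finset.card_range, nsmul_eq_mul, mul_one]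
    rw [one_div, inv_mul_cancel₀ hr'.ne', one_pow]
  have hQsum : ∀ k, Q.natDegree < k → ∑ i ∈ Finset.range k, Q.coeff i = 1 := by
    intro k hk
    rw [← hQ1, eval_eq_sum_range' hk]
    simp
  have hQsum' : ∀ k, ∑ i ∈ Finset.range k, Q.coeff i ≤ 1 := by
    intro k
    rw [← hQsum (max k (Q.natDegree + 1)) (by omega)]
    refine Finset.sum_le_sum_of_subset_of_nonneg ?_ fun i _ _ => hQnn i
    exact Finset.range_subset_range.2 (le_max_left _ _)
  have hWcoeff : ∀ j, W.coeff j =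
      ∑ i ∈ (Finset.range N).filter (· ≤ j), Q.coeff (j - i) := by
    intro j
    rw [hW, Finset.sum_mul, finsetSum_coeff, Finset.sum_filter]
    exact Finset.sum_congr rfl fun i _ => coeff_X_pow_mul' _ _ _
  refine ⟨fun j => W.coeff j, fun j => ?_, fun j => ?_, fun j hmj hjN => ?_, fun z hz hz1 => ?_⟩
  · simp only [hWcoeff]
    exact Finset.sum_nonneg fun i _ => hQnn _
  · simp only [hWcoeff]
    calc _ ≤ ∑ i ∈ Finset.range (j + 1), Q.coeff (j - i) := by
          refine Finset.sum_le_sum_of_subset_of_nonneg ?_ fun i _ _ => hQnn _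
          intro i hi
          rw [Finset.mem_filter] at hi
          exact Finset.mem_range.2 (by omega)
      _ = ∑ i ∈ Finset.range (j + 1), Q.coeff i := by
          rw [← Finset.sum_range_reflect]
          refine Finset.sum_congr rfl fun i hi => ?_
          have := Finset.mem_range.1 hi
          congr 1
          omega
      _ ≤ 1 := hQsum' _
  · simp only [hWcoeff]
    have h1 : (Finset.range N).filter (· ≤ j) = Finset.range (j + 1) := by
      ext i
      simp only [Finset.mem_filter, Finset.mem_range]
      omega
    rw [h1, ← hQsum (j + 1) (by omega), ← Finset.sum_range_reflect]
    refine Finset.sum_congr rfl fun i hi => ?_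
    have := Finset.mem_range.1 hi
    congr 1
    omega
  · have h1 : ∑ j ∈ Finset.range n, ((W.coeff j : ℝ) : ℂ) * z ^ j = aeval z W := by
      rw [aeval_eq_sum_range' hWdeg]
      simp only [Complex.real_smul]
    have h2 : aeval z W = (∑ i ∈ Finset.range N, z ^ i) *
        (((1 / r : ℝ) : ℂ) * ∑ i ∈ Finset.range r, z ^ i) ^ p := by
      rw [hW, hQ, hf]
      simp only [map_mul, map_pow, map_sum, aeval_X, aeval_C]
      rfl
    rw [h1, h2, norm_mul, norm_pow, norm_mul, Complex.norm_real]
    refine mul_le_mul (norm_sum_range_pow_le hz N) ?_ (by positivity) (by positivity)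
    refine pow_le_pow_left₀ (by positivity) ?_ p
    rw [Real.norm_of_nonneg (by positivity)]
    refine (mul_le_mul_of_nonneg_left (norm_sum_range_pow_le_div hz hz1 r) (by positivity)).trans
      (le_of_eq ?_)
    rw [div_mul_div_comm, one_mul]

end Window

section TrigProduct

/-- A product of translated sines is a trigonometric sum. -/
lemma exists_prod_sin_eq_sum (A : Multiset ℝ) : ∃ C : ℕ → ℂ, ∀ x : ℝ,
    (((A.map fun α => Real.sin (x - α)).prod : ℝ) : ℂ) =
      ∑ k ∈ Finset.range (A.card + 1),
        C k * Complex.exp ((((2 * k - A.card : ℝ) * x : ℝ) : ℂ) * Complex.I) := by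
  induction A using Multiset.induction_on with
  | empty => exact ⟨fun _ => 1, fun x => by simp⟩
  | cons α A ih =>
    obtain ⟨C, hC⟩ := ih
    set u : ℂ := Complex.exp (-(α : ℂ) * Complex.I) / (2 * Complex.I) with hu
    set v : ℂ := -(Complex.exp ((α : ℂ) * Complex.I) / (2 * Complex.I)) with hv
    have hsin : ∀ x : ℝ, ((Real.sin (x - α) : ℝ) : ℂ) =
        u * Complex.exp ((x : ℂ) * Complex.I) + v * Complex.exp (-(x : ℂ) * Complex.I) := by
      intro x
      have h1 := Complex.exp_ne_zero ((x : ℂ) * Complex.I)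
      have h2 := Complex.exp_ne_zero ((α : ℂ) * Complex.I)
      rw [Complex.ofReal_sin, Complex.sin, hu, hv]
      push_cast
      rw [show -((x : ℂ) - α) * Complex.I = α * Complex.I + -x * Complex.I by ring,
        show ((x : ℂ) - α) * Complex.I = x * Complex.I + -α * Complex.I by ring,
        Complex.exp_add, Complex.exp_add]
      field_simp
      rw [Complex.I_sq]
      ring
    refine ⟨fun k => (if k = 0 then 0 else u * C (k - 1)) + if k ≤ A.card then v * C k else 0,
      fun x => ?_⟩
    rw [Multiset.map_cons, Multiset.prod_cons, Complex.ofReal_mul, hC, hsin, Multiset.card_cons,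
      add_mul]
    simp only [add_mul, Finset.sum_add_distrib]
    congr 1
    · rw [Finset.sum_range_succ' _ (A.card + 1)]
      simp only [if_pos, zero_mul, add_zero, Nat.add_eq_zero_iff, one_ne_zero, and_false, if_false,
        Nat.add_sub_cancel]
      rw [Finset.mul_sum]
      refine Finset.sum_congr rfl fun k _ => ?_
      rw [mul_mul_mul_comm, ← Complex.exp_add]
      congr 2
      push_cast
      ring
    · rw [Finset.sum_range_succ _ (A.card + 1)]
      rw [if_neg (by omega), zero_mul, add_zero, Finset.mul_sum]
      refine Finset.sum_congr rfl fun k hk => ?_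
      have := Finset.mem_range.1 hk
      rw [if_pos (by omega), mul_mul_mul_comm, ← Complex.exp_add]
      congr 2
      push_cast
      ring

lemma norm_coeff_le_of_trig_sum {d n : ℕ} (hd : d < n) {C : ℕ → ℂ} {a : ℕ → ℂ}
    (ha : ∀ j < n, a j = ∑ k ∈ Finset.range (d + 1),
      C k * Complex.exp ((((2 * k - d : ℝ) * (Real.pi * j / n) : ℝ) : ℂ) * Complex.I))
    (hb : ∀ j < n, ‖a j‖ ≤ 1) : ∀ k ≤ d, ‖C k‖ ≤ 1 := by
  intro k hk
  have hn : n ≠ 0 := by omega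
  have hnC : (n : ℂ) ≠ 0 := by exact_mod_cast hn
  set ζ := Complex.exp (2 * Real.pi * Complex.I / n) with hζ
  have hprim : IsPrimitiveRoot ζ n := Complex.isPrimitiveRoot_exp n hn
  have hζ0 : ζ ≠ 0 := Complex.exp_ne_zero _
  have horth : ∀ k' ≤ d, ∑ j ∈ Finset.range n, (ζ ^ k' / ζ ^ k) ^ j = if k' = k then (n : ℂ) else 0 := by
    intro k' hk'
    split_ifs with h
    · rw [h, div_self (pow_ne_zero _ hζ0)]
      simp
    · have h1 : ζ ^ k' / ζ ^ k ≠ 1 := by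
        intro h2
        rw [div_eq_one_iff_eq (pow_ne_zero _ hζ0)] at h2
        exact h (hprim.pow_inj (by omega) (by omega) h2)
      rw [geom_sum_eq h1, div_pow, ← pow_mul, ← pow_mul, mul_comm k', mul_comm k, pow_mul, pow_mul,
        hprim.pow_eq_one]
      simp
  have hinv : ∑ j ∈ Finset.range n,
      a j * Complex.exp (((-((2 * k - d : ℝ) * (Real.pi * j / n)) : ℝ) : ℂ) * Complex.I) =
      n * C k := by
    calc _ = ∑ j ∈ Finset.range n, ∑ k' ∈ Finset.range (d + 1), C k' * (ζ ^ k' / ζ ^ k) ^ j := by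
          refine Finset.sum_congr rfl fun j hj => ?_
          rw [ha j (Finset.mem_range.1 hj), Finset.sum_mul]
          refine Finset.sum_congr rfl fun k' _ => ?_
          rw [mul_assoc, ← Complex.exp_add, hζ, ← Complex.exp_nat_mul, ← Complex.exp_nat_mul,
            ← Complex.exp_sub, ← Complex.exp_nat_mul]
          congr 2
          push_cast
          field_simp
          ring
      _ = ∑ k' ∈ Finset.range (d + 1), C k' * if k' = k then (n : ℂ) else 0 := by
          rw [Finset.sum_comm]
          refine Finset.sum_congr rfl fun k' hk' => ?_
          rw [← Finset.mul_sum, horth k' (by have := Finset.mem_range.1 hk'; omega)]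
      _ = n * C k := by
          simp only [mul_ite, mul_zero, Finset.sum_ite_eq', Finset.mem_range]
          rw [if_pos (by omega), mul_comm]
  have h1 : ‖(n : ℂ) * C k‖ ≤ n := by
    rw [← hinv]
    refine (norm_sum_le_of_le (f := fun j => a j *
      Complex.exp (((-((2 * k - d : ℝ) * (Real.pi * j / n)) : ℝ) : ℂ) * Complex.I))
      (n := fun _ => (1 : ℝ)) _ fun j hj => ?_).trans (by simp)
    rw [norm_mul, Complex.norm_exp_ofReal_mul_I, mul_one]
    exact hb j (Finset.mem_range.1 hj)
  rw [norm_mul, Complex.norm_natCast] at h1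
  have hn0 : (0 : ℝ) < n := by exact_mod_cast Nat.pos_of_ne_zero hn
  exact le_of_mul_le_mul_left (by rwa [mul_one]) hn0

end TrigProduct

section GoodIndices

/-- Sequences that are finite exponential sums with total coefficient mass at most `A` and
frequencies of size at most `γ`. -/
def IsExpSum (A γ : ℝ) (b : ℕ → ℂ) : Prop :=
  ∃ (N : ℕ) (c : Fin N → ℂ) (φ : Fin N → ℝ), (∑ s, ‖c s‖ ≤ A) ∧ (∀ s, |φ s| ≤ γ) ∧
    ∀ i, b i = ∑ s, c s * Complex.exp (((φ s * i : ℝ) : ℂ) * Complex.I)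

lemma IsExpSum.mul_sub {A γ ψ : ℝ} (hψ : 0 ≤ ψ) {b : ℕ → ℂ} (hb : IsExpSum A γ b) (x : ℝ) :
    IsExpSum (2 * A) (γ + ψ) fun i => b i *
      (Complex.exp (((ψ * i : ℝ) : ℂ) * Complex.I) - Complex.exp (((x : ℝ) : ℂ) * Complex.I)) := by
  obtain ⟨N, c, φ, hc, hφ, hb⟩ := hb
  refine ⟨N + N, Fin.append c fun s => -(Complex.exp (((x : ℝ) : ℂ) * Complex.I) * c s),
    Fin.append (fun s => φ s + ψ) φ, ?_, ?_, fun i => ?_⟩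
  · rw [Fin.sum_univ_add]
    simp only [Fin.append_left, Fin.append_right, norm_neg, norm_mul,
      Complex.norm_exp_ofReal_mul_I, one_mul]
    linarith
  · intro s
    refine Fin.addCases (fun s => ?_) (fun s => ?_) s
    · rw [Fin.append_left]
      refine (abs_add_le _ _).trans ?_
      rw [abs_of_nonneg hψ]
      linarith [hφ s]
    · rw [Fin.append_right]
      linarith [hφ s]
  · simp only [hb]
    rw [Fin.sum_univ_add, _root_.mul_sub, Finset.sum_mul, Finset.sum_mul, sub_eq_add_neg,
      ← Finset.sum_neg_distrib]
    simp only [Fin.append_left, Fin.append_right]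
    congr 1
    · refine Finset.sum_congr rfl fun s _ => ?_
      rw [mul_assoc, ← Complex.exp_add]
      congr 2
      push_cast
      ring
    · refine Finset.sum_congr rfl fun s _ => ?_
      ring

lemma IsExpSum.mul_prod {A γ ψ : ℝ} (hψ : 0 ≤ ψ) {b : ℕ → ℂ} (hb : IsExpSum A γ b) (G : Finset ℕ) :
    IsExpSum (A * 2 ^ G.card) (γ + G.card * ψ) fun i => b i * ∏ l ∈ G,
      (Complex.exp (((ψ * i : ℝ) : ℂ) * Complex.I) -
        Complex.exp (((ψ * l : ℝ) : ℂ) * Complex.I)) := by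
  induction G using Finset.induction_on with
  | empty => simpa using hb
  | insert l G hl ih =>
    have h := ih.mul_sub hψ (ψ * l)
    rw [Finset.card_insert_of_notMem hl]
    have h1 : A * 2 ^ (G.card + 1) = 2 * (A * 2 ^ G.card) := by ring
    have h2 : γ + ((G.card + 1 : ℕ) : ℝ) * ψ = γ + G.card * ψ + ψ := by
      push_cast
      ring
    rw [h1, h2]
    convert h using 2
    rw [Finset.prod_insert hl]
    ring

lemma IsExpSum.norm_alternating_sum_le {A γ : ℝ} {b : ℕ → ℂ} (hb : IsExpSum A γ b) (hγ : 0 ≤ γ)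
    (K : ℕ) :
    ‖∑ i ∈ Finset.range (K + 1), (-1 : ℂ) ^ (K - i) * K.choose i * b i‖ ≤ A * γ ^ K := by
  obtain ⟨N, c, φ, hc, hφ, hb⟩ := hb
  have h1 : ∑ i ∈ Finset.range (K + 1), (-1 : ℂ) ^ (K - i) * K.choose i * b i =
      ∑ s, c s * (Complex.exp (Complex.I * (φ s : ℂ)) - 1) ^ K := by
    simp_rw [hb, Finset.mul_sum]
    rw [Finset.sum_comm]
    refine Finset.sum_congr rfl fun s _ => ?_
    rw [sub_eq_add_neg, add_pow, Finset.mul_sum]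
    refine Finset.sum_congr rfl fun i _ => ?_
    rw [← Complex.exp_nat_mul]
    have h2 : (((φ s * i : ℝ) : ℂ) * Complex.I) = i * (Complex.I * (φ s : ℂ)) := by
      push_cast
      ring
    rw [h2]
    ring
  rw [h1]
  have hA : ∑ s, ‖c s‖ * γ ^ K ≤ A * γ ^ K := by
    rw [← Finset.sum_mul]
    gcongr
  refine (norm_sum_le_of_le _ fun s _ => ?_).trans hA
  rw [norm_mul, norm_pow]
  gcongr
  exact (Real.norm_exp_I_mul_ofReal_sub_one_le).trans (hφ s)

lemma half_le_norm_exp_sub_one {θ : ℝ} (h0 : 0 ≤ θ) (h1 : θ ≤ 1) :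
    θ / 2 ≤ ‖Complex.exp ((θ : ℂ) * Complex.I) - 1‖ := by
  have h2 := Complex.abs_im_le_norm (Complex.exp ((θ : ℂ) * Complex.I) - 1)
  rw [Complex.sub_im, Complex.exp_ofReal_mul_I_im, Complex.one_im, sub_zero] at h2
  have h3 := abs_div_four_le_abs_sin (x := θ) (by
    rw [abs_of_nonneg h0]; linarith [Real.pi_gt_three])
  have h4 := Real.mul_le_sin h0 (by linarith [Real.pi_gt_three])
  have h5 : (1 : ℝ) / 2 ≤ 2 / Real.pi := by
    rw [div_le_div_iff₀ (by norm_num) Real.pi_pos]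
    linarith [Real.pi_le_four]
  have h6 := le_abs_self (Real.sin θ)
  nlinarith

lemma factorial_card_le_prod (G : Finset ℕ) (h : ∀ l ∈ G, 1 ≤ l) :
    G.card.factorial ≤ ∏ l ∈ G, l := by
  induction G using Finset.induction_on_max with
  | empty => simp
  | insert a s hmax ih =>
    have ha : a ∉ s := fun h => lt_irrefl _ (hmax a h)
    rw [Finset.card_insert_of_notMem ha, Finset.prod_insert ha, Nat.factorial_succ]
    refine Nat.mul_le_mul ?_ (ih fun l hl => h l (Finset.mem_insert_of_mem hl))
    have hsub : s ⊆ Finset.Ico 1 a := fun l hl =>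
      Finset.mem_Ico.2 ⟨h l (Finset.mem_insert_of_mem hl), hmax l hl⟩
    have h1 := Finset.card_le_card hsub
    rw [Nat.card_Ico] at h1
    have := h a (Finset.mem_insert_self _ _)
    omega

lemma not_good_of_card_le {A ψ : ℝ} {q g K : ℕ} (hA : 0 ≤ A) (hK : K = 2 * q) (hq : 0 < q)
    (hG : g ≤ q) (hψ0 : 0 < ψ) (hψK : ψ * K = 1 / 1000)
    (hsmall : A * Real.exp (-(2 * q : ℝ)) < 1 / 2)
    (hmain : (ψ / 2) ^ g * g.factorial ≤
      2 ^ K * ((1 / 16 : ℝ) ^ K / 4 * (1 / 1000) ^ g) + A * 2 ^ g * (1 / 1000) ^ K) : False := by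
  have hK0 : (0 : ℝ) < K := by exact_mod_cast (by omega : 0 < K)
  have hfac : (K : ℝ) ^ g ≤ Real.exp K * g.factorial := by
    have := Real.pow_div_factorial_le_exp (K : ℝ) hK0.le g
    rwa [div_le_iff₀ (by positivity)] at this
  have hgq : g + (q - g) = q := by omega
  have hKg : g + (K - g) = K := by omega
  have h1000 : (1 / 1000 : ℝ) ^ K = (1 / 1000) ^ g * (1 / 1000) ^ (K - g) := by
    rw [← pow_add, hKg]
  have hψg : (1 / 1000 : ℝ) ^ g = ψ ^ g * K ^ g := by rw [← mul_pow, hψK]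
  have hred : Real.exp (-(K : ℝ)) * (1 / 2) ^ g ≤
      2 ^ K * ((1 / 16 : ℝ) ^ K / 4) + A * 2 ^ g * (1 / 1000) ^ (K - g) := by
    have h1 : (1 / 1000 : ℝ) ^ g * (Real.exp (-(K : ℝ)) * (1 / 2) ^ g) ≤
        (ψ / 2) ^ g * g.factorial := by
      have h0 : ((1 : ℝ) / 2) ^ g = (2 ^ g)⁻¹ := by rw [one_div, inv_pow]
      rw [h0, hψg, div_pow, Real.exp_neg]
      calc ψ ^ g * K ^ g * ((Real.exp K)⁻¹ * (2 ^ g)⁻¹)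
          ≤ ψ ^ g * (Real.exp K * g.factorial) * ((Real.exp K)⁻¹ * (2 ^ g)⁻¹) := by gcongr
        _ = _ := by
          have := (Real.exp_pos (K : ℝ)).ne'
          field_simp
    have h2 : (0 : ℝ) < (1 / 1000) ^ g := by positivity
    refine le_of_mul_le_mul_left (h1.trans (hmain.trans (le_of_eq ?_))) h2
    rw [h1000]
    ring
  have hKr : (K : ℝ) = 2 * q := by rw [hK]; push_cast; ring
  have he1 : Real.exp (-(K : ℝ)) = (Real.exp (-2)) ^ q := by
    rw [← Real.exp_nat_mul, hKr]
    congr 1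
    ring
  have hehalf : Real.exp (-(2 : ℝ)) < 1 / 4 := by
    have h1 := Real.exp_one_gt_d9
    have h2 : Real.exp 2 = Real.exp 1 * Real.exp 1 := by rw [← Real.exp_add]; norm_num
    rw [Real.exp_neg, inv_lt_comm₀ (Real.exp_pos _) (by norm_num), h2]
    nlinarith
  have helow : (1 : ℝ) / 9 < Real.exp (-(2 : ℝ)) := by
    have h1 := Real.exp_one_lt_d9
    have h0 := Real.exp_pos 1
    have h2 : Real.exp 2 = Real.exp 1 * Real.exp 1 := by rw [← Real.exp_add]; norm_num
    rw [Real.exp_neg, lt_inv_comm₀ (by norm_num) (Real.exp_pos _), h2]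
    nlinarith
  set E := Real.exp (-(2 : ℝ)) with hE
  have hE0 : 0 < E := Real.exp_pos _
  have hL : E ^ q * (1 / 2) ^ q ≤ Real.exp (-(K : ℝ)) * (1 / 2) ^ g := by
    rw [he1]
    have : (1 / 2 : ℝ) ^ q ≤ (1 / 2) ^ g := pow_le_pow_of_le_one (by norm_num) (by norm_num) hG
    gcongr
  have hR1 : (2 : ℝ) ^ K * ((1 / 16 : ℝ) ^ K / 4) ≤ E ^ q * (1 / 2) ^ q / 4 := by
    have : (2 : ℝ) ^ K * (1 / 16 : ℝ) ^ K ≤ E ^ q * (1 / 2) ^ q := by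
      rw [← mul_pow, ← mul_pow, hK, pow_mul]
      refine pow_le_pow_left₀ (by norm_num) ?_ q
      linarith
    linarith
  have hR2 : A * 2 ^ g * (1 / 1000) ^ (K - g) < E ^ q * (1 / 2) ^ q / 2 := by
    have h1 : (2 : ℝ) ^ g ≤ 2 ^ q := pow_le_pow_right₀ (by norm_num) hG
    have h2 : (1 / 1000 : ℝ) ^ (K - g) ≤ (1 / 1000) ^ q :=
      pow_le_pow_of_le_one (by norm_num) (by norm_num) (by omega)
    have h3 : (2 : ℝ) ^ q * (1 / 1000) ^ q ≤ E ^ q * (E ^ q * (1 / 2) ^ q) := by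
      rw [← mul_pow, ← mul_pow, ← mul_pow]
      refine pow_le_pow_left₀ (by norm_num) ?_ q
      nlinarith
    have h4 : A * E ^ q < 1 / 2 := by
      rw [← he1, hKr]
      exact hsmall
    calc A * 2 ^ g * (1 / 1000) ^ (K - g) ≤ A * 2 ^ q * (1 / 1000) ^ q := by gcongr
      _ = A * (2 ^ q * (1 / 1000) ^ q) := by ring
      _ ≤ A * (E ^ q * (E ^ q * (1 / 2) ^ q)) := by gcongr
      _ = A * E ^ q * (E ^ q * (1 / 2) ^ q) := by ring
      _ < 1 / 2 * (E ^ q * (1 / 2) ^ q) := by gcongr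
      _ = _ := by ring
  have hpos : 0 < E ^ q * (1 / 2) ^ q := by positivity
  linarith

/-- A short exponential sum with small frequencies cannot be tiny at most of the indices following
an index where it is large. -/
lemma IsExpSum.lt_card_filter {A β : ℝ} {b : ℕ → ℂ} (hb : IsExpSum A β b) (hA : 0 ≤ A)
    (hβ0 : 0 ≤ β) (hβ : β ≤ 1 / 2000) (hb0 : ‖b 0‖ = 1) {q : ℕ} (hq : 0 < q)
    (hsmall : A * Real.exp (-(2 * q : ℝ)) < 1 / 2) :
    q < ((Finset.Icc 1 (2 * q)).filter fun i => (1 / 16 : ℝ) ^ (2 * q) / 4 ≤ ‖b i‖).card := by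
  by_contra! hG
  set K := 2 * q with hK
  set G := (Finset.Icc 1 K).filter fun i => (1 / 16 : ℝ) ^ K / 4 ≤ ‖b i‖ with hGdef
  set g := G.card with hg
  have hK0 : (0 : ℝ) < K := by exact_mod_cast (by omega : 0 < K)
  set ψ : ℝ := 1 / 1000 / K with hψ
  have hψ0 : 0 < ψ := by positivity
  have hψK : ψ * K = 1 / 1000 := by rw [hψ]; field_simp
  have hGmem : ∀ l ∈ G, 1 ≤ l ∧ l ≤ K := fun l hl =>
    Finset.mem_Icc.1 (Finset.mem_filter.1 hl).1
  have hψl : ∀ l : ℕ, l ≤ K → ψ * l ≤ 1 / 1000 := by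
    intro l hl
    rw [← hψK]
    have : (l : ℝ) ≤ K := by exact_mod_cast hl
    gcongr
  set b' : ℕ → ℂ := fun i => b i * ∏ l ∈ G,
      (Complex.exp (((ψ * i : ℝ) : ℂ) * Complex.I) -
        Complex.exp (((ψ * l : ℝ) : ℂ) * Complex.I)) with hb'
  have hb'exp : IsExpSum (A * 2 ^ g) (β + g * ψ) b' := hb.mul_prod hψ0.le G
  have hfd := hb'exp.norm_alternating_sum_le (by positivity) K
  have hgψ : g * ψ ≤ 1 / 2000 := by
    have h1 : (g : ℝ) ≤ q := by exact_mod_cast hG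
    have h2 : (q : ℝ) * ψ = 1 / 2000 := by
      rw [hψ, hK]
      push_cast
      have : (q : ℝ) ≠ 0 := by exact_mod_cast hq.ne'
      field_simp
      norm_num
    rw [← h2]
    gcongr
  have hup : A * 2 ^ g * (β + g * ψ) ^ K ≤ A * 2 ^ g * (1 / 1000) ^ K := by
    gcongr
    linarith
  rw [Finset.sum_range_succ'] at hfd
  set R := ∑ i ∈ Finset.range K, (-1 : ℂ) ^ (K - (i + 1)) * K.choose (i + 1) * b' (i + 1) with hR
  have hRle : ‖R‖ ≤ 2 ^ K * ((1 / 16 : ℝ) ^ K / 4 * (1 / 1000) ^ g) := by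
    have h1 : ∀ i ∈ Finset.range K, ‖(-1 : ℂ) ^ (K - (i + 1)) * K.choose (i + 1) * b' (i + 1)‖ ≤
        K.choose (i + 1) * ((1 / 16 : ℝ) ^ K / 4 * (1 / 1000) ^ g) := by
      intro i hi
      have hiK := Finset.mem_range.1 hi
      rw [norm_mul, norm_mul, norm_pow, norm_neg, norm_one, one_pow, one_mul, Complex.norm_natCast]
      refine mul_le_mul_of_nonneg_left ?_ (by positivity)
      simp only [hb']
      by_cases hmem : i + 1 ∈ G
      · rw [Finset.prod_eq_zero hmem (sub_self _), mul_zero, norm_zero]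
        positivity
      · have h2 : ‖b (i + 1)‖ ≤ (1 / 16 : ℝ) ^ K / 4 := by
          by_contra! h3
          exact hmem (Finset.mem_filter.2 ⟨Finset.mem_Icc.2 ⟨by omega, by omega⟩, h3.le⟩)
        rw [norm_mul, norm_prod]
        refine mul_le_mul h2 ?_ (Finset.prod_nonneg fun _ _ => norm_nonneg _) (by positivity)
        rw [hg, ← Finset.prod_const]
        refine Finset.prod_le_prod (fun _ _ => norm_nonneg _) fun l hl => ?_
        have h4 : Complex.exp (((ψ * (i + 1 : ℕ) : ℝ) : ℂ) * Complex.I) -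
            Complex.exp (((ψ * l : ℝ) : ℂ) * Complex.I) =
            Complex.exp (((ψ * l : ℝ) : ℂ) * Complex.I) *
              (Complex.exp (Complex.I * ((ψ * (i + 1 : ℕ) - ψ * l : ℝ) : ℂ)) - 1) := by
          rw [_root_.mul_sub, mul_one, ← Complex.exp_add]
          congr 2
          push_cast
          ring
        rw [h4, norm_mul, Complex.norm_exp_ofReal_mul_I, one_mul]
        refine Real.norm_exp_I_mul_ofReal_sub_one_le.trans ?_
        have h5 := hψl (i + 1) (by omega)
        have h6 := hψl l (hGmem l hl).2
        rw [Real.norm_eq_abs, abs_le]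
        constructor
        · have : 0 ≤ ψ * (i + 1 : ℕ) := by positivity
          linarith
        · have : 0 ≤ ψ * l := by positivity
          linarith
    refine (norm_sum_le_of_le _ h1).trans ?_
    rw [← Finset.sum_mul]
    refine mul_le_mul_of_nonneg_right ?_ (by positivity)
    have h2 : ∑ i ∈ Finset.range K, K.choose (i + 1) ≤ 2 ^ K := by
      rw [← Nat.sum_range_choose K, Finset.sum_range_succ']
      omega
    exact_mod_cast h2
  have hlow : (ψ / 2) ^ g * g.factorial ≤ ‖(-1 : ℂ) ^ (K - 0) * K.choose 0 * b' 0‖ := by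
    rw [norm_mul, norm_mul, norm_pow, norm_neg, norm_one, one_pow, one_mul, Nat.choose_zero_right,
      Nat.cast_one, norm_one, one_mul]
    simp only [hb']
    rw [norm_mul, hb0, one_mul, norm_prod]
    have h1 : (g.factorial : ℝ) ≤ ∏ l ∈ G, (l : ℝ) := by
      have := factorial_card_le_prod G fun l hl => (hGmem l hl).1
      rw [← hg] at this
      rw [← Nat.cast_prod]
      exact Nat.cast_le.2 this
    calc (ψ / 2) ^ g * g.factorial ≤ (ψ / 2) ^ g * ∏ l ∈ G, (l : ℝ) := by gcongr
      _ = ∏ l ∈ G, (ψ / 2 * l) := by rw [Finset.prod_mul_distrib, Finset.prod_const]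
      _ ≤ _ := by
        refine Finset.prod_le_prod (fun l _ => by positivity) fun l hl => ?_
        have h2 := half_le_norm_exp_sub_one (θ := ψ * l) (by positivity)
          (by linarith [hψl l (hGmem l hl).2])
        rw [norm_sub_rev]
        simp only [Nat.cast_zero, mul_zero, Complex.ofReal_zero, zero_mul, Complex.exp_zero]
        linarith
  have htri : ‖(-1 : ℂ) ^ (K - 0) * K.choose 0 * b' 0‖ ≤
      ‖R + (-1 : ℂ) ^ (K - 0) * K.choose 0 * b' 0‖ + ‖R‖ := by
    have := norm_sub_le (R + (-1 : ℂ) ^ (K - 0) * K.choose 0 * b' 0) R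
    rwa [add_sub_cancel_left] at this
  have hmain : (ψ / 2) ^ g * g.factorial ≤
      2 ^ K * ((1 / 16 : ℝ) ^ K / 4 * (1 / 1000) ^ g) + A * 2 ^ g * (1 / 1000) ^ K := by linarith
  exact not_good_of_card_le hA hK hq hG hψ0 hψK hsmall hmain

end GoodIndices

section Leak

lemma norm_windowed_sum_le {w a : ℕ → ℝ} {n N r p d : ℕ} {C : ℕ → ℂ} {η : ℝ} (hr : 0 < r)
    (hη : 0 < η) (hrη : 4 * Real.exp 1 ≤ r * η)
    (hw : ∀ z : ℂ, ‖z‖ = 1 → z ≠ 1 →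
      ‖∑ j ∈ Finset.range n, (w j : ℂ) * z ^ j‖ ≤ N * (2 / (r * ‖z - 1‖)) ^ p)
    (hC : ∀ k ≤ d, ‖C k‖ ≤ 1)
    (ha : ∀ j : ℕ, (a j : ℂ) = ∑ k ∈ Finset.range (d + 1),
      C k * Complex.exp ((((2 * k - d : ℝ) * (Real.pi * j / n) : ℝ) : ℂ) * Complex.I))
    {x : ℝ} (hx : Real.pi * d / n + η ≤ |x|) (hx1 : |x| + Real.pi * d / n ≤ 1) :
    ‖∑ j ∈ Finset.range n, ((w j * a j : ℝ) : ℂ) * Complex.exp (((x * j : ℝ) : ℂ) * Complex.I)‖ ≤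
      (d + 1) * (N * Real.exp (-p)) := by
  wlog hx0 : 0 ≤ x generalizing x
  · have h1 := this (x := -x) (by rwa [abs_neg]) (by rwa [abs_neg]) (by linarith)
    rw [← Complex.norm_conj, map_sum] at h1
    convert h1 using 5 with j
    rw [map_mul, Complex.conj_ofReal, ← Complex.exp_conj, map_mul, Complex.conj_ofReal,
      Complex.conj_I]
    congr 2
    push_cast
    ring
  rw [abs_of_nonneg hx0] at hx hx1
  have hsum : ∑ j ∈ Finset.range n,
      ((w j * a j : ℝ) : ℂ) * Complex.exp (((x * j : ℝ) : ℂ) * Complex.I) =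
      ∑ k ∈ Finset.range (d + 1), C k * ∑ j ∈ Finset.range n, (w j : ℂ) *
        Complex.exp (((x + (2 * k - d) * (Real.pi / n) : ℝ) : ℂ) * Complex.I) ^ j := by
    simp_rw [Finset.mul_sum]
    rw [Finset.sum_comm]
    refine Finset.sum_congr rfl fun j _ => ?_
    rw [Complex.ofReal_mul, ha, Finset.mul_sum, Finset.sum_mul]
    refine Finset.sum_congr rfl fun k _ => ?_
    rw [← Complex.exp_nat_mul]
    have h1 : ((j : ℂ) * (((x + (2 * k - d) * (Real.pi / n) : ℝ) : ℂ) * Complex.I)) =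
        (((2 * k - d : ℝ) * (Real.pi * j / n) : ℝ) : ℂ) * Complex.I +
          ((x * j : ℝ) : ℂ) * Complex.I := by
      push_cast
      ring
    rw [h1, Complex.exp_add]
    ring
  rw [hsum]
  refine (norm_sum_le_of_le (n := fun _ => (N : ℝ) * Real.exp (-p)) _ fun k hk => ?_).trans
    (le_of_eq (by simp))
  have hkd : k ≤ d := by
    have := Finset.mem_range.1 hk
    omega
  have hkd' : (k : ℝ) ≤ d := by exact_mod_cast hkd
  set θ := x + (2 * k - d) * (Real.pi / n) with hθ
  have hpn : 0 ≤ Real.pi / n := by positivity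
  have hd : Real.pi * d / n = d * (Real.pi / n) := by ring
  rw [hd] at hx hx1
  have hθη : η ≤ θ := by
    have : 0 ≤ (2 * k : ℝ) * (Real.pi / n) := by positivity
    rw [hθ, sub_mul]
    linarith
  have hθ1 : θ ≤ 1 := by
    have : (2 * k - d : ℝ) * (Real.pi / n) ≤ d * (Real.pi / n) := by
      refine mul_le_mul_of_nonneg_right ?_ hpn
      linarith
    rw [hθ]
    linarith
  have hlow := half_le_norm_exp_sub_one (hη.le.trans hθη) hθ1
  have hne : Complex.exp ((θ : ℂ) * Complex.I) ≠ 1 := by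
    intro h
    rw [h, sub_self, norm_zero] at hlow
    linarith
  rw [norm_mul]
  have h1 := hw _ (Complex.norm_exp_ofReal_mul_I θ) hne
  have h2 : (2 / (r * ‖Complex.exp ((θ : ℂ) * Complex.I) - 1‖)) ^ p ≤ Real.exp (-p) := by
    have hr' : (0 : ℝ) < r := by exact_mod_cast hr
    have : Real.exp (-(p : ℝ)) = (Real.exp (-1)) ^ p := by
      rw [← Real.exp_nat_mul]
      congr 1
      ring
    rw [this]
    refine pow_le_pow_left₀ (by positivity) ?_ p
    rw [Real.exp_neg, div_le_iff₀ (mul_pos hr' (by linarith))]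
    rw [inv_mul_eq_div, le_div_iff₀ (Real.exp_pos 1)]
    have : r * η ≤ r * (2 * ‖Complex.exp ((θ : ℂ) * Complex.I) - 1‖) := by
      gcongr
      linarith
    linarith
  calc _ ≤ 1 * (N * (2 / (r * ‖Complex.exp ((θ : ℂ) * Complex.I) - 1‖)) ^ p) := by
        gcongr
        exact hC k hkd
    _ ≤ N * Real.exp (-p) := by
        rw [one_mul]
        gcongr

end Leak

section SignPattern

lemma abs_le_abs_sum_of_mul_nonneg {ι : Type*} {s : Finset ι} {f : ι → ℝ}
    (h : ∀ i ∈ s, ∀ j ∈ s, 0 ≤ f i * f j) {j : ι} (hj : j ∈ s) : |f j| ≤ |∑ i ∈ s, f i| := by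
  classical
  have h1 : f j * f j ≤ f j * ∑ i ∈ s, f i := by
    rw [Finset.mul_sum]
    exact Finset.single_le_sum (f := fun i => f j * f i) (fun i hi => h j hj i hi) hj
  have h2 : |f j| * |f j| ≤ |f j| * |∑ i ∈ s, f i| := by
    rw [← abs_mul, ← abs_mul, abs_of_nonneg (mul_self_nonneg _)]
    exact h1.trans (le_abs_self _)
  rcases (abs_nonneg (f j)).eq_or_lt with h3 | h3
  · rw [← h3]
    exact abs_nonneg _
  · exact le_of_mul_le_mul_left h2 h3

lemma sin_half_sub_ne_zero_and_sign {n j z : ℕ} (hj : j < n) (hz : z + 1 < n) :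
    (z < j → 0 < Real.sin (Real.pi * j / n - Real.pi * (z + 1 / 2) / n)) ∧
    (j ≤ z → Real.sin (Real.pi * j / n - Real.pi * (z + 1 / 2) / n) < 0) := by
  have hn : (0 : ℝ) < n := by exact_mod_cast (by omega : 0 < n)
  have hj' : (j : ℝ) < n := by exact_mod_cast hj
  have hz' : (z : ℝ) + 1 < n := by exact_mod_cast hz
  have hj0 : (0 : ℝ) ≤ j := by positivity
  have hz0 : (0 : ℝ) ≤ z := by positivity
  have h1 : Real.pi * j / n - Real.pi * (z + 1 / 2) / n =
      Real.pi * ((j - (z + 1 / 2)) / n) := by ring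
  rw [h1]
  have hpi := Real.pi_pos
  constructor
  · intro h
    have h' : (z : ℝ) + 1 ≤ j := by exact_mod_cast h
    refine Real.sin_pos_of_pos_of_lt_pi ?_ ?_
    · have : 0 < (j - (z + 1 / 2)) / (n : ℝ) := div_pos (by linarith) hn
      positivity
    · have : (j - (z + 1 / 2)) / (n : ℝ) < 1 := by
        rw [div_lt_one hn]
        linarith
      nlinarith
  · intro h
    have h' : (j : ℝ) ≤ z := by exact_mod_cast h
    refine Real.sin_neg_of_neg_of_neg_pi_lt ?_ ?_
    · have : (j - (z + 1 / 2)) / (n : ℝ) < 0 := div_neg_of_neg_of_pos (by linarith) hn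
      nlinarith
    · have : -1 < (j - (z + 1 / 2)) / (n : ℝ) := by
        rw [lt_div_iff₀ hn]
        linarith
      nlinarith

lemma sin_pi_sub_eq_zero_iff {n j l : ℕ} (hj : j < n) (hl : l < n) :
    Real.sin (Real.pi * j / n - Real.pi * l / n) = 0 ↔ j = l := by
  have hn : (0 : ℝ) < n := by exact_mod_cast (by omega : 0 < n)
  constructor
  · intro h
    rw [Real.sin_eq_zero_iff] at h
    obtain ⟨k, hk⟩ := h
    have h1 : (k : ℝ) * n = j - l := by
      field_simp at hk
      linarith
    have h2 : k * n = (j : ℤ) - l := by exact_mod_cast h1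
    have h3 : k = 0 := by
      by_contra h0
      rcases lt_or_gt_of_ne h0 with h4 | h4
      · nlinarith
      · nlinarith
    rw [h3] at h2
    omega
  · rintro rfl
    simp

/-- The product of sines over half-integer points changes sign exactly across `Z`. -/
lemma prod_sin_mul_prod_sin_succ {n : ℕ} {Z : Finset ℕ} (hZ : ∀ z ∈ Z, z + 1 < n) {j : ℕ}
    (hj : j + 1 < n) :
    (j ∈ Z → (∏ z ∈ Z, Real.sin (Real.pi * j / n - Real.pi * (z + 1 / 2) / n)) *
      ∏ z ∈ Z, Real.sin (Real.pi * (j + 1 : ℕ) / n - Real.pi * (z + 1 / 2) / n) < 0) ∧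
    (j ∉ Z → 0 < (∏ z ∈ Z, Real.sin (Real.pi * j / n - Real.pi * (z + 1 / 2) / n)) *
      ∏ z ∈ Z, Real.sin (Real.pi * (j + 1 : ℕ) / n - Real.pi * (z + 1 / 2) / n)) := by
  set f : ℕ → ℝ := fun z => Real.sin (Real.pi * j / n - Real.pi * (z + 1 / 2) / n) *
    Real.sin (Real.pi * (j + 1 : ℕ) / n - Real.pi * (z + 1 / 2) / n) with hf
  have hne : ∀ z ∈ Z, z ≠ j → 0 < f z := by
    intro z hz hzj
    obtain ⟨h1, h2⟩ := sin_half_sub_ne_zero_and_sign (show j < n by omega) (hZ z hz)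
    obtain ⟨h3, h4⟩ := sin_half_sub_ne_zero_and_sign hj (hZ z hz)
    rcases lt_or_gt_of_ne hzj with h | h
    · exact mul_pos (h1 h) (h3 (by omega))
    · exact mul_pos_of_neg_of_neg (h2 h.le) (h4 h)
  rw [← Finset.prod_mul_distrib]
  constructor
  · intro hjZ
    rw [← Finset.mul_prod_erase _ _ hjZ]
    refine mul_neg_of_neg_of_pos ?_ (Finset.prod_pos fun z hz =>
      hne z (Finset.mem_of_mem_erase hz) (Finset.ne_of_mem_erase hz))
    exact mul_neg_of_neg_of_pos
      ((sin_half_sub_ne_zero_and_sign (show j < n by omega) (hZ j hjZ)).2 le_rfl)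
      ((sin_half_sub_ne_zero_and_sign hj (hZ j hjZ)).1 (by omega))
  · intro hjZ
    exact Finset.prod_pos fun z hz => hne z hz fun h => hjZ (h ▸ hz)

lemma mul_pos_of_consecutive {n : ℕ} {y : ℕ → ℝ} (h : ∀ j, j + 1 < n → 0 < y j * y (j + 1))
    {i j : ℕ} (hij : i < j) (hj : j < n) : 0 < y i * y j := by
  induction j, hij using Nat.le_induction with
  | base => exact h i hj
  | succ k hk ih =>
    have h1 := ih (by omega)
    have h2 := h k hj
    have h3 : 0 < (y k) ^ 2 := by
      have : y k ≠ 0 := by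
        rintro h0
        rw [h0] at h2
        simp at h2
      positivity
    have h4 : 0 < (y i * y (k + 1)) * (y k) ^ 2 := by
      have := mul_pos h1 h2
      linarith
    exact pos_of_mul_pos_left h4 h3.le

/-- A real trigonometric sum of low degree whose sign pattern follows `Z`, vanishing on a collar. -/
lemma exists_adapted_trig_sum {n m : ℕ} (hm : 2 * m < n) {Z : Finset ℕ}
    (hZ : ∀ z ∈ Z, z + 1 < n) (hd : Z.card + 4 * m < n) :
    ∃ (a : ℕ → ℝ) (j₀ : ℕ) (C : ℕ → ℂ),
      (∀ k ≤ Z.card + 4 * m, ‖C k‖ ≤ 1) ∧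
      (∀ j : ℕ, (a j : ℂ) = ∑ k ∈ Finset.range (Z.card + 4 * m + 1), C k *
        Complex.exp ((((2 * k - (Z.card + 4 * m : ℕ) : ℝ) * (Real.pi * j / n) : ℝ) : ℂ) *
          Complex.I)) ∧
      (m ≤ j₀ ∧ j₀ + m < n ∧ |a j₀| = 1) ∧
      (∀ j < n, a j ≠ 0 → m ≤ j ∧ j + m < n) ∧
      ∀ X : ℕ → ℝ, (∀ j < n, X j ≠ 0) → (∀ j, j + 1 < n → (X j * X (j + 1) < 0 ↔ j ∈ Z)) →
        ∀ i < n, ∀ j < n, 0 ≤ (a i * X i) * (a j * X j) := by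
  classical
  set L : Finset ℕ := Finset.range m ∪ Finset.Ico (n - m) n with hL
  have hLn : ∀ l ∈ L, l < n := by
    intro l hl
    rw [hL, Finset.mem_union, Finset.mem_range, Finset.mem_Ico] at hl
    omega
  have hLmem : ∀ j < n, j ∉ L ↔ m ≤ j ∧ j + m < n := by
    intro j hj
    rw [hL, Finset.mem_union, Finset.mem_range, Finset.mem_Ico]
    omega
  have hLcard : L.card = 2 * m := by
    rw [hL, Finset.card_union_of_disjoint, Finset.card_range, Nat.card_Ico]
    · omega
    · rw [Finset.disjoint_left]
      intro x hx hx'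
      rw [Finset.mem_range] at hx
      rw [Finset.mem_Ico] at hx'
      omega
  set A : Multiset ℝ := Z.val.map (fun z : ℕ => Real.pi * ((z : ℝ) + 1 / 2) / n) +
    (L.val.map (fun l : ℕ => Real.pi * (l : ℝ) / n) +
      L.val.map (fun l : ℕ => Real.pi * (l : ℝ) / n)) with hA
  have hAcard : A.card = Z.card + 4 * m := by
    rw [hA]
    simp only [Multiset.card_add, Multiset.card_map, Finset.card_val, hLcard]
    omega
  set s : ℕ → ℝ := fun j => ∏ z ∈ Z, Real.sin (Real.pi * j / n - Real.pi * (z + 1 / 2) / n) with hs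
  set g : ℕ → ℝ := fun j => ∏ l ∈ L, Real.sin (Real.pi * j / n - Real.pi * l / n) with hg
  have hAprod : ∀ j : ℕ, (A.map fun α => Real.sin (Real.pi * j / n - α)).prod =
      s j * (g j * g j) := by
    intro j
    rw [hA, Multiset.map_add, Multiset.map_add, Multiset.prod_add, Multiset.prod_add,
      Multiset.map_map, Multiset.map_map]
    rfl
  have hs0 : ∀ j < n, s j ≠ 0 := by
    intro j hj
    rw [hs, Finset.prod_ne_zero_iff]
    intro z hz
    obtain ⟨h1, h2⟩ := sin_half_sub_ne_zero_and_sign hj (hZ z hz)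
    rcases lt_or_ge z j with h | h
    · exact (h1 h).ne'
    · exact (h2 h).ne
  have hg0 : ∀ j < n, g j ≠ 0 ↔ m ≤ j ∧ j + m < n := by
    intro j hj
    rw [← hLmem j hj, hg, Finset.prod_ne_zero_iff]
    constructor
    · intro h hjL
      exact h j hjL ((sin_pi_sub_eq_zero_iff hj hj).2 rfl)
    · intro h l hl h0
      rw [sin_pi_sub_eq_zero_iff hj (hLn l hl)] at h0
      exact h (h0 ▸ hl)
  obtain ⟨j₀, hj₀, hmax⟩ := Finset.exists_max_image (Finset.range n)
    (fun j => |s j * (g j * g j)|) ⟨m, Finset.mem_range.2 (by omega)⟩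
  rw [Finset.mem_range] at hj₀
  set t := |s j₀ * (g j₀ * g j₀)| with ht
  have ht0 : 0 < t := by
    refine lt_of_lt_of_le ?_ (hmax m (Finset.mem_range.2 (by omega)))
    have h1 := (hg0 m (by omega)).2 ⟨le_rfl, by omega⟩
    have h2 := hs0 m (by omega)
    exact abs_pos.2 (mul_ne_zero h2 (mul_ne_zero h1 h1))
  obtain ⟨C, hC⟩ := exists_prod_sin_eq_sum A
  rw [hAcard] at hC
  set a : ℕ → ℝ := fun j => t⁻¹ * (s j * (g j * g j)) with ha
  have haC : ∀ j : ℕ, (a j : ℂ) = ∑ k ∈ Finset.range (Z.card + 4 * m + 1), ((t⁻¹ : ℝ) : ℂ) * C k *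
        Complex.exp ((((2 * k - (Z.card + 4 * m : ℕ) : ℝ) * (Real.pi * j / n) : ℝ) : ℂ) *
          Complex.I) := by
    intro j
    rw [ha, Complex.ofReal_mul, ← hAprod, hC, Finset.mul_sum]
    simp only [mul_assoc]
  refine ⟨a, j₀, fun k => ((t⁻¹ : ℝ) : ℂ) * C k, ?_, haC, ?_, ?_, ?_⟩
  · refine norm_coeff_le_of_trig_sum hd (a := fun j => (a j : ℂ)) (fun j _ => haC j) fun j hj => ?_
    rw [Complex.norm_real, Real.norm_eq_abs, ha, abs_mul, abs_of_pos (inv_pos.2 ht0),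
      inv_mul_le_one₀ ht0]
    exact hmax j (Finset.mem_range.2 hj)
  · have h1 : g j₀ ≠ 0 := by
      intro h0
      rw [ht, h0] at ht0
      simp at ht0
    refine ⟨((hg0 j₀ hj₀).1 h1).1, ((hg0 j₀ hj₀).1 h1).2, ?_⟩
    rw [ha, abs_mul, abs_of_pos (inv_pos.2 ht0), ← ht, inv_mul_cancel₀ ht0.ne']
  · intro j hj h
    refine (hg0 j hj).1 fun h0 => h ?_
    rw [ha]
    simp [h0]
  · intro X hX hXZ i hi j hj
    have hcons : ∀ j, j + 1 < n → 0 < (s j * X j) * (s (j + 1) * X (j + 1)) := by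
      intro j hj
      obtain ⟨h1, h2⟩ := prod_sin_mul_prod_sin_succ hZ hj
      have h3 : (s j * X j) * (s (j + 1) * X (j + 1)) =
        (s j * s (j + 1)) * (X j * X (j + 1)) := by ring
      rw [h3]
      by_cases hjZ : j ∈ Z
      · exact mul_pos_of_neg_of_neg (h1 hjZ) ((hXZ j hj).2 hjZ)
      · refine mul_pos (h2 hjZ) ?_
        have h4 : ¬ X j * X (j + 1) < 0 := fun h => hjZ ((hXZ j hj).1 h)
        exact lt_of_le_of_ne (not_lt.1 h4)
          (mul_ne_zero (hX j (by omega)) (hX _ hj)).symm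
    have hpos : 0 ≤ (s i * X i) * (s j * X j) := by
      rcases lt_trichotomy i j with h | h | h
      · exact (mul_pos_of_consecutive hcons h hj).le
      · rw [h]
        exact mul_self_nonneg _
      · rw [mul_comm]
        exact (mul_pos_of_consecutive hcons h hi).le
    have h5 : (a i * X i) * (a j * X j) =
        ((t⁻¹ * (g i * g j)) ^ 2) * ((s i * X i) * (s j * X j)) := by
      simp only [ha]
      ring
    rw [h5]
    positivity

end SignPattern

section Weights

lemma exists_adapted_weights {n m N r p q : ℕ} {η β : ℝ} (hm : 2 * m < n) (hn : n = N + m)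
    (hr : 0 < r) (hpr : p * r ≤ m) (hη : 0 < η) (hrη : 4 * Real.exp 1 ≤ r * η)
    (hβ : β ≤ 1 / 2000) {Z : Finset ℕ} (hZ : ∀ z ∈ Z, z + 1 < n)
    (hd : Real.pi * (Z.card + 4 * m : ℕ) / n + η ≤ β) (hq : 0 < q) (hqm : 2 * q ≤ m)
    (hsmall : n * Real.exp (-(2 * q : ℝ)) < 1 / 2) :
    ∃ v : ℕ → ℝ,
      (∀ x : ℝ, β ≤ |x| → |x| + β ≤ 1 →
        ‖∑ j ∈ Finset.range n, (v j : ℂ) * Complex.exp (((x * j : ℝ) : ℂ) * Complex.I)‖ ≤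
          n ^ 2 * Real.exp (-p)) ∧
      ∀ X : ℕ → ℝ, (∀ j < n, X j ≠ 0) → (∀ j, j + 1 < n → (X j * X (j + 1) < 0 ↔ j ∈ Z)) →
        ∀ x : ℝ, |∑ j ∈ Finset.range n, v j * X j| ≤ x →
          ∃ j₀ < n, ∃ I ∈ (Finset.Icc 1 (2 * q)).powerset, q < I.card ∧
            ∀ i ∈ I, |X (j₀ + i)| ≤ 4 * 16 ^ (2 * q) * x := by
  have hn0 : (0 : ℝ) < n := by exact_mod_cast (by omega : 0 < n)
  set d := Z.card + 4 * m with hd_def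
  have hπd : 0 ≤ Real.pi * (d : ℝ) / n := by positivity
  have hdn : d < n := by
    have h1 : Real.pi * (d : ℝ) / n < 1 := by linarith
    rw [div_lt_one hn0] at h1
    have h2 : (d : ℝ) ≤ Real.pi * d := by
      have := Real.pi_gt_three
      nlinarith [show (0 : ℝ) ≤ d by positivity]
    exact_mod_cast h2.trans_lt h1
  obtain ⟨a, j₀, C, hC, haC, ⟨hj₀, hj₀', haj₀⟩, hcore, hsign⟩ := exists_adapted_trig_sum hm hZ hdn
  obtain ⟨w, hw0, hw1, hwcore, hw⟩ := exists_window hr hpr (by omega : 0 < N) hn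
  have hβ0 : 0 ≤ β := by linarith
  refine ⟨fun j => w j * a j, fun x hx hx1 => ?_, fun X hX hXZ x hx => ?_⟩
  · refine (norm_windowed_sum_le (d := d) hr hη hrη hw hC haC (hd.trans hx) (by linarith)).trans ?_
    have h1 : ((d : ℝ) + 1) ≤ n := by exact_mod_cast hdn
    have h2 : (N : ℝ) ≤ n := by exact_mod_cast (by omega : N ≤ n)
    rw [← mul_assoc, sq]
    gcongr
  · have hb : IsExpSum (d + 1) β fun i => (a (j₀ + i) : ℂ) := by
      refine ⟨d + 1, fun k => C k * Complex.exp
        ((((2 * (k : ℕ) - d : ℝ) * (Real.pi * j₀ / n) : ℝ) : ℂ) * Complex.I),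
        fun k => (2 * (k : ℕ) - d) * (Real.pi / n), ?_, fun k => ?_, fun i => ?_⟩
      · refine (Finset.sum_le_card_nsmul _ _ 1 fun k _ => ?_).trans (by simp)
        rw [norm_mul, Complex.norm_exp_ofReal_mul_I, mul_one]
        exact hC _ (by have := k.2; omega)
      · have hk : ((k : ℕ) : ℝ) ≤ d := by
          exact_mod_cast (by have := k.2; omega : (k : ℕ) ≤ d)
        have hk0 : (0 : ℝ) ≤ (k : ℕ) := by positivity
        rw [abs_mul, abs_of_nonneg (show 0 ≤ Real.pi / n by positivity)]
        have h1 : |(2 * (k : ℕ) - d : ℝ)| ≤ d := abs_le.2 ⟨by linarith, by linarith⟩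
        calc _ ≤ (d : ℝ) * (Real.pi / n) := by gcongr
          _ = Real.pi * d / n := by ring
          _ ≤ β := by linarith
      · rw [← hd_def] at haC
        refine (haC _).trans ?_
        rw [Finset.sum_range]
        refine Finset.sum_congr rfl fun k _ => ?_
        rw [mul_assoc, ← Complex.exp_add]
        congr 2
        push_cast
        ring
    have hb0 : ‖((a (j₀ + 0) : ℝ) : ℂ)‖ = 1 := by
      rw [add_zero, Complex.norm_real, Real.norm_eq_abs, haj₀]
    have hsmall' : ((d : ℝ) + 1) * Real.exp (-(2 * q : ℝ)) < 1 / 2 := by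
      refine lt_of_le_of_lt ?_ hsmall
      have h1 : ((d : ℝ) + 1) ≤ n := by exact_mod_cast hdn
      gcongr
    have hcard := hb.lt_card_filter (by positivity) hβ0 hβ hb0 hq hsmall'
    refine ⟨j₀, by omega, _, Finset.mem_powerset.2 (Finset.filter_subset _ _), hcard,
      fun i hi => ?_⟩
    rw [Finset.mem_filter, Finset.mem_Icc, Complex.norm_real, Real.norm_eq_abs] at hi
    obtain ⟨⟨-, hi2⟩, hia⟩ := hi
    have hin : j₀ + i < n := by omega
    have hc : (0 : ℝ) < (1 / 16) ^ (2 * q) / 4 := by positivity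
    have hane : a (j₀ + i) ≠ 0 := fun h0 => by
      rw [h0, abs_zero] at hia
      linarith
    obtain ⟨h1, h2⟩ := hcore _ hin hane
    have h3 := abs_le_abs_sum_of_mul_nonneg (s := Finset.range n) (f := fun j => w j * a j * X j)
      (fun i hi j hj => by
        have h4 := hsign X hX hXZ i (Finset.mem_range.1 hi) j (Finset.mem_range.1 hj)
        have h5 := mul_nonneg (mul_nonneg (hw0 i) (hw0 j)) h4
        linarith) (Finset.mem_range.2 hin)
    simp only [hwcore _ h1 (by omega), one_mul, abs_mul] at h3
    have h4 : (1 / 16 : ℝ) ^ (2 * q) / 4 * |X (j₀ + i)| ≤ x :=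
      ((mul_le_mul_of_nonneg_right hia (abs_nonneg _)).trans h3).trans hx
    have h5 : (1 / 16 : ℝ) ^ (2 * q) * 16 ^ (2 * q) = 1 := by
      rw [← mul_pow]
      norm_num
    calc |X (j₀ + i)| = 4 * 16 ^ (2 * q) * ((1 / 16 : ℝ) ^ (2 * q) / 4 * |X (j₀ + i)|) := by
          linear_combination (-|X (j₀ + i)|) * h5
      _ ≤ _ := by gcongr

end Weights

section SignChanges

/-- The indices `j` with `j + 1 < n` at which a sequence changes sign. -/
noncomputable def signChanges (n : ℕ) (X : ℕ → ℝ) : Finset ℕ :=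
  (Finset.range (n - 1)).filter fun j => X j * X (j + 1) < 0

lemma mem_signChanges {n : ℕ} {X : ℕ → ℝ} {j : ℕ} (hj : j + 1 < n) :
    j ∈ signChanges n X ↔ X j * X (j + 1) < 0 := by
  rw [signChanges, Finset.mem_filter, Finset.mem_range, and_iff_right (by omega)]

lemma lt_of_mem_signChanges {n : ℕ} {X : ℕ → ℝ} {j : ℕ} (hj : j ∈ signChanges n X) :
    j + 1 < n := by
  rw [signChanges, Finset.mem_filter, Finset.mem_range] at hj
  omega

/-- Each sign change of the samples forces a zero in the corresponding sampling interval. -/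
lemma card_signChanges_le_zeroCount {Ω : Type*} {F : ℝ → Ω → ℝ} {ω : Ω} {h T : ℝ} {n : ℕ}
    (hcont : Continuous fun t => F t ω) (h0 : 0 < h) (hnT : n * h ≤ T) :
    ((signChanges n fun j => F (j * h) ω).card : ℕ∞) ≤ zeroCount F T ω := by
  have key : ∀ j ∈ signChanges n fun j => F (j * h) ω,
      ∃ t, (j : ℝ) * h < t ∧ t < ((j + 1 : ℕ) : ℝ) * h ∧ F t ω = 0 := by
    intro j hj
    have h1 := (mem_signChanges (lt_of_mem_signChanges hj)).1 hj
    have hlt : (j : ℝ) * h < ((j + 1 : ℕ) : ℝ) * h := by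
      push_cast
      linarith
    rcases mul_neg_iff.1 h1 with ⟨h2, h3⟩ | ⟨h2, h3⟩
    · obtain ⟨t, ht, ht0⟩ := intermediate_value_Ioo' hlt.le hcont.continuousOn ⟨h3, h2⟩
      exact ⟨t, ht.1, ht.2, ht0⟩
    · obtain ⟨t, ht, ht0⟩ := intermediate_value_Ioo hlt.le hcont.continuousOn ⟨h2, h3⟩
      exact ⟨t, ht.1, ht.2, ht0⟩
  choose! t ht1 ht2 ht3 using key
  rw [zeroCount, ← Set.encard_coe_eq_coe_finsetCard]
  refine Set.encard_le_encard_of_injOn (f := t) (fun j hj => ?_) fun i hi j hj hij => ?_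
  · have hj' := lt_of_mem_signChanges hj
    have h1 : ((j + 1 : ℕ) : ℝ) ≤ n := by exact_mod_cast hj'.le
    have h2 : ((j + 1 : ℕ) : ℝ) * h ≤ n * h := by gcongr
    have h3 : 0 ≤ (j : ℝ) * h := by positivity
    exact ⟨⟨by linarith [ht1 j hj], by linarith [ht2 j hj]⟩, ht3 j hj⟩
  · have aux : ∀ i ∈ signChanges n (fun j => F (j * h) ω),
        ∀ j ∈ signChanges n (fun j => F (j * h) ω), i < j → t i < t j := by
      intro i hi j hj hlt
      have h1 : ((i + 1 : ℕ) : ℝ) * h ≤ (j : ℝ) * h := by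
        have : ((i + 1 : ℕ) : ℝ) ≤ j := by exact_mod_cast hlt
        gcongr
      exact (ht2 i hi).trans_le (h1.trans (ht1 j hj).le)
    rcases lt_trichotomy i j with h1 | h1 | h1
    · exact absurd hij (aux i hi j hj h1).ne
    · exact h1
    · exact absurd hij (aux j hj i hi h1).ne'

end SignChanges

section Undercrowding

variable {Ω : Type*} [MeasurableSpace Ω] {P : Measure Ω} {μ : Measure ℝ} {F : ℝ → Ω → ℝ}

lemma measure_biUnion_finset_le_ofReal {ι : Type*} (s : Finset ι) (A : ι → Set Ω) {C y : ℝ}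
    (hC : (s.card : ℝ) ≤ C) (hy : 0 ≤ y) (h : ∀ i ∈ s, P (A i) ≤ ENNReal.ofReal y) :
    P (⋃ i ∈ s, A i) ≤ ENNReal.ofReal (C * y) := by
  refine (measure_biUnion_finset_le s A).trans ((Finset.sum_le_card_nsmul _ _ _ h).trans ?_)
  rw [← ENNReal.ofReal_nsmul, nsmul_eq_mul]
  exact ENNReal.ofReal_le_ofReal (by gcongr)

/-- A weighted sum of samples whose symbol is small on the spectrum is rarely large. -/
lemma IsSGP.measure_le_abs_sum_range [IsProbabilityMeasure P] [IsProbabilityMeasure μ]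
    (hF : IsSGP P μ F) {h σ x : ℝ} {n : ℕ} {v : ℕ → ℝ} (hσ : 0 < σ) (hx : 0 ≤ x)
    (hv : ∀ᵐ l ∂μ, ‖∑ j ∈ Finset.range n,
      (v j : ℂ) * Complex.exp (((l * h * j : ℝ) : ℂ) * Complex.I)‖ ≤ σ) :
    P {ω | x ≤ |∑ j ∈ Finset.range n, v j * F (j * h) ω|} ≤
      ENNReal.ofReal (2 * Real.exp (-(x ^ 2 / (2 * σ ^ 2)))) := by
  have h1 := hF.measure_le_abs_sum (fun i : Fin n => (i : ℕ) * h) (fun i => v i) hσ hx ?_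
  · simpa only [Finset.sum_range] using h1
  · have h2 : ∀ᵐ l ∂μ, ‖∑ i : Fin n, ((v i : ℝ) : ℂ) *
        Complex.exp (((l * ((i : ℕ) * h) : ℝ) : ℂ) * Complex.I)‖ ^ 2 ≤ σ ^ 2 := by
      filter_upwards [hv] with l hl
      refine pow_le_pow_left₀ (norm_nonneg _) ?_ 2
      rw [Finset.sum_range] at hl
      have h3 : ∀ i : Fin n, l * ((i : ℕ) * h) = l * h * (i : ℕ) := fun i => by ring
      simpa only [h3] using hl
    calc _ ≤ ∫ _, σ ^ 2 ∂μ :=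
          integral_mono_of_nonneg (ae_of_all _ fun l => by positivity) (integrable_const _) h2
      _ = σ ^ 2 := by simp

/-- Many samples in a short block are rarely simultaneously small. -/
lemma IsSGP.measure_forall_mem_abs_le [IsProbabilityMeasure P] [IsProbabilityMeasure μ]
    (hF : IsSGP P μ F) {h κ δ ρ : ℝ} {K q j₀ : ℕ} {I : Finset ℕ} (hκ : 0 < κ) (hδ : 0 < δ)
    (hlow : ∀ (k j₀ : ℕ) (e : Fin k → ℕ), Function.Injective e →
      (∀ i, e i ≤ K) → ∀ c : Fin k → ℝ, κ ^ 2 * ∑ i, c i ^ 2 ≤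
        ∫ l, ‖∑ i, (c i : ℂ) *
          Complex.exp (((l * (((j₀ + e i : ℕ) : ℝ) * h) : ℝ) : ℂ) * Complex.I)‖ ^ 2 ∂μ)
    (hI : I ⊆ Finset.Icc 1 K) (hq : q < I.card) (hρ : 2 * δ / κ ≤ ρ) (hρ1 : ρ ≤ 1) :
    P {ω | ∀ i ∈ I, |F ((j₀ + i : ℕ) * h) ω| ≤ δ} ≤ ENNReal.ofReal (ρ ^ q) := by
  set e : Fin I.card → ℕ := fun i => I.orderEmbOfFin rfl i with he
  have h1 := hF.measure_forall_abs_le (fun i => (j₀ + e i : ℕ) * h) hκ hδ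
    (hlow _ j₀ e (I.orderEmbOfFin rfl).injective fun i =>
      (Finset.mem_Icc.1 (hI (I.orderEmbOfFin_mem rfl i))).2)
  refine (measure_mono fun ω hω => ?_).trans (h1.trans (ENNReal.ofReal_le_ofReal ?_))
  · exact fun i => hω _ (I.orderEmbOfFin_mem rfl i)
  · have h0 : 0 ≤ 2 * δ / κ := by positivity
    exact (pow_le_pow_left₀ h0 hρ _).trans (pow_le_pow_of_le_one (h0.trans hρ) hρ1 hq.le)

lemma IsSGP.measure_zeroCount_le [IsProbabilityMeasure P] [IsProbabilityMeasure μ]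
    (hF : IsSGP P μ F) {B M h κ η S T ρ : ℝ} {n m r p q : ℕ}
    (hB : ∀ᵐ l ∂μ, B ≤ |l|) (hM : ∀ᵐ l ∂μ, |l| ≤ M) (h0 : 0 < h) (hnT : n * h ≤ T)
    (hm : 2 * m < n) (hr : 0 < r) (hpr : p * r ≤ m) (hη : 0 < η)
    (hrη : 4 * Real.exp 1 ≤ r * η) (hβ : B * h ≤ 1 / 2000) (hβM : M * h + B * h ≤ 1)
    (hS : ∀ k : ℕ, (k : ℝ) ≤ S → Real.pi * (k + 4 * m : ℕ) / n + η ≤ B * h)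
    (hq : 0 < q) (hqm : 2 * q ≤ m) (hsmall : n * Real.exp (-(2 * q : ℝ)) < 1 / 2)
    (hκ : 0 < κ)
    (hlow : ∀ (K k j₀ : ℕ) (e : Fin k → ℕ), Function.Injective e →
      (∀ i, e i ≤ K) → ∀ c : Fin k → ℝ, (κ ^ (K + 1)) ^ 2 * ∑ i, c i ^ 2 ≤
        ∫ l, ‖∑ i, (c i : ℂ) *
          Complex.exp (((l * (((j₀ + e i : ℕ) : ℝ) * h) : ℝ) : ℂ) * Complex.I)‖ ^ 2 ∂μ)
    (hρ : 2 * (4 * 16 ^ (2 * q) * (n ^ 2 * Real.exp (-(p / 2 : ℝ)))) / κ ^ (2 * q + 1) ≤ ρ)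
    (hρ1 : ρ ≤ 1) :
    P {ω | ∃ k : ℕ, zeroCount F T ω = k ∧ (k : ℝ) ≤ S} ≤
      ENNReal.ofReal (2 ^ n * (2 * Real.exp (-(Real.exp p / 2))) +
        n * 2 ^ (2 * q) * ρ ^ q) := by
  classical
  have hn0 : (0 : ℝ) < n := by exact_mod_cast (by omega : 0 < n)
  set x := (n : ℝ) ^ 2 * Real.exp (-(p / 2 : ℝ)) with hx
  have hx0 : 0 < x := by positivity
  set 𝒵 := (Finset.range (n - 1)).powerset.filter fun Z =>
    Real.pi * (Z.card + 4 * m : ℕ) / n + η ≤ B * h with h𝒵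
  have hv : ∀ Z ∈ 𝒵, _ := fun Z hZ => exists_adapted_weights (p := p) (q := q) (Z := Z) hm
    (show n = (n - m) + m by omega) hr hpr hη hrη hβ
    (fun z hz => by
      have := Finset.mem_range.1 (Finset.mem_powerset.1 (Finset.mem_filter.1 hZ).1 hz)
      omega)
    (Finset.mem_filter.1 hZ).2 hq hqm hsmall
  choose! v hv1 hv2 using hv
  set 𝒥 := Finset.range n ×ˢ (Finset.Icc 1 (2 * q)).powerset.filter fun I => q < I.card with h𝒥
  have hnull : P {ω | ¬ ∀ j : ℕ, F (j * h) ω ≠ 0} = 0 := by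
    have : ∀ᵐ ω ∂P, ∀ j : ℕ, F (j * h) ω ≠ 0 := ae_all_iff.2 fun j => hF.ae_ne_zero _
    exact this
  have hZb : P (⋃ Z ∈ 𝒵, {ω | x ≤ |∑ j ∈ Finset.range n, v Z j * F (j * h) ω|}) ≤
      ENNReal.ofReal (2 ^ n * (2 * Real.exp (-(Real.exp p / 2)))) := by
    refine measure_biUnion_finset_le_ofReal _ _ ?_ (by positivity) fun Z hZ => ?_
    · have h1 : 𝒵.card ≤ 2 ^ n := by
        refine (Finset.card_filter_le _ _).trans ?_
        rw [Finset.card_powerset, Finset.card_range]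
        exact Nat.pow_le_pow_right (by norm_num) (by omega)
      exact_mod_cast h1
    · have h1 := hF.measure_le_abs_sum_range (h := h) (n := n) (v := v Z)
        (σ := n ^ 2 * Real.exp (-p)) (x := x) (by positivity) hx0.le (by
          filter_upwards [hB, hM] with l hl hl'
          have h2 : |l * h| = |l| * h := by rw [abs_mul, abs_of_pos h0]
          refine hv1 Z hZ (l * h) ?_ ?_
          · rw [h2]
            gcongr
          · rw [h2]
            have : |l| * h ≤ M * h := by gcongr
            linarith)
      convert h1 using 5
      rw [hx]
      have h3 : Real.exp (p : ℝ) * Real.exp (-(p : ℝ)) ^ 2 = Real.exp (-(p / 2 : ℝ)) ^ 2 := by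
        rw [← Real.exp_nat_mul, ← Real.exp_nat_mul, ← Real.exp_add]
        congr 1
        push_cast
        ring
      rw [div_eq_div_iff (by norm_num) (by positivity), mul_pow, mul_pow, ← h3]
      ring
  have hJb : P (⋃ y ∈ 𝒥, {ω | ∀ i ∈ y.2, |F ((y.1 + i : ℕ) * h) ω| ≤ 4 * 16 ^ (2 * q) * x}) ≤
      ENNReal.ofReal (n * 2 ^ (2 * q) * ρ ^ q) := by
    have hρ0 : 0 ≤ ρ := le_trans (by positivity) hρ
    refine measure_biUnion_finset_le_ofReal _ _ ?_ (by positivity) fun y hy => ?_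
    · have h1 : 𝒥.card ≤ n * 2 ^ (2 * q) := by
        rw [h𝒥, Finset.card_product, Finset.card_range]
        refine Nat.mul_le_mul_left _ ((Finset.card_filter_le _ _).trans ?_)
        rw [Finset.card_powerset, Nat.card_Icc]
        simp
      exact_mod_cast h1
    · rw [h𝒥, Finset.mem_product, Finset.mem_filter, Finset.mem_powerset] at hy
      exact hF.measure_forall_mem_abs_le (pow_pos hκ (2 * q + 1)) (by positivity)
        (hlow (2 * q)) hy.2.1 hy.2.2 hρ hρ1
  rw [ENNReal.ofReal_add (by positivity)
    (by have : 0 ≤ ρ := le_trans (by positivity) hρ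
        positivity)]
  refine le_trans ?_ (add_le_add hZb hJb)
  refine le_trans ?_ (measure_union_le _ _)
  have hunion : ∀ s : Set Ω, P ({ω | ¬ ∀ j : ℕ, F (j * h) ω ≠ 0} ∪ s) ≤ P s := fun s =>
    (measure_union_le _ s).trans (by rw [hnull, zero_add])
  refine le_trans ?_ (hunion _)
  refine measure_mono fun ω hω => ?_
  obtain ⟨k, hk, hkS⟩ := hω
  by_cases hne : ∀ j : ℕ, F (j * h) ω ≠ 0
  swap
  · exact Or.inl hne
  refine Or.inr ?_
  set Z := signChanges n fun j => F (j * h) ω with hZdef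
  have hZk : (Z.card : ℝ) ≤ S := by
    have h1 := card_signChanges_le_zeroCount (hF.1 ω) h0 hnT
    rw [hk] at h1
    have h2 : Z.card ≤ k := by exact_mod_cast h1
    exact le_trans (by exact_mod_cast h2) hkS
  have hZ : Z ∈ 𝒵 := Finset.mem_filter.2
    ⟨Finset.mem_powerset.2 (Finset.filter_subset _ _), hS _ hZk⟩
  by_cases hbig : x ≤ |∑ j ∈ Finset.range n, v Z j * F (j * h) ω|
  · exact Or.inl (Set.mem_iUnion₂.2 ⟨Z, hZ, hbig⟩)
  · refine Or.inr ?_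
    obtain ⟨j₀, hj₀, I, hI, hqI, hIx⟩ := hv2 Z hZ (fun j => F (j * h) ω) (fun j _ => hne j)
      (fun j hj => (mem_signChanges (X := fun j => F (j * h) ω) hj).symm) x (not_le.1 hbig).le
    exact Set.mem_iUnion₂.2 ⟨(j₀, I),
      Finset.mem_product.2 ⟨Finset.mem_range.2 hj₀, Finset.mem_filter.2 ⟨hI, hqI⟩⟩, hIx⟩

end Undercrowding

section Parameters

lemma exists_discretization {h L ε T : ℝ} (h0 : 0 < h) (h1 : h ≤ 1) (hL : 2 ≤ L)
    (hT : 8 ≤ Real.log T) (hT1 : 1 ≤ T) (hε0 : 0 < ε) (hε1 : ε ≤ 1)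
    (hu : 100 * L * Real.log T ≤ h / 2176 * (ε ^ 2 * T)) :
    ∃ n m r p q : ℕ, n * h ≤ T ∧ T ≤ (n + 1) * h ∧ (n : ℝ) ≤ T ^ 2 ∧ 2 * m < n ∧ 0 < r ∧
      p * r ≤ m ∧ 16 ≤ r * (ε * h) ∧ 16 * (m : ℝ) ≤ ε * h * n ∧
      h / 2176 * (ε ^ 2 * T) ≤ p ∧ 0 < q ∧ 2 * q ≤ m ∧ 16 * L * q ≤ p ∧ p ≤ 32 * L * q := by
  have hLT : 1600 ≤ 100 * L * Real.log T := by nlinarith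
  have hhu : 2176 * 1600 ≤ h * (ε ^ 2 * T) := by linarith
  have huεT : ε ^ 2 * T ≤ ε * T := by
    have : ε ^ 2 ≤ ε := by nlinarith
    gcongr
  have huT : ε * T ≤ T := by nlinarith
  have hhu1 : h * (ε ^ 2 * T) ≤ ε ^ 2 * T := mul_le_of_le_one_left (by positivity) h1
  have hhT : 1 ≤ h * T := by
    have : h * (ε ^ 2 * T) ≤ h * T := by gcongr; linarith
    linarith
  have hεh : 0 < ε * h := mul_pos hε0 h0
  have hεh1 : ε * h ≤ 1 := mul_le_one₀ hε1 h0.le h1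
  set n := ⌊T / h⌋₊ with hn
  have hn1 : n * h ≤ T := by
    rw [← le_div_iff₀ h0]
    exact Nat.floor_le (by positivity)
  have hn2 : T ≤ (n + 1) * h := by
    rw [← div_le_iff₀ h0]
    exact (Nat.lt_floor_add_one _).le
  have hn3 : (n : ℝ) ≤ T ^ 2 := by
    have h2 : (n : ℝ) ≤ n * (h * T) := le_mul_of_one_le_right (by positivity) hhT
    nlinarith
  have hn4 : T / 2 ≤ n * h := by linarith
  have hn5 : (0 : ℝ) < n := by
    by_contra h2
    nlinarith
  set m := ⌊ε * h * n / 16⌋₊ with hm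
  have hm1 : (m : ℝ) ≤ ε * h * n / 16 := Nat.floor_le (by positivity)
  have hm2 : ε * T / 64 ≤ m := by
    have h2 := (Nat.lt_floor_add_one (ε * h * n / 16)).le
    rw [← hm] at h2
    have h3 : ε * (T / 2) ≤ ε * (n * h) := by gcongr
    linarith
  set r := ⌈16 / (ε * h)⌉₊ with hr
  have hr1 : 16 / (ε * h) ≤ r := Nat.le_ceil _
  rw [div_le_iff₀ hεh] at hr1
  have hr2 : r * (ε * h) ≤ 17 := by
    have h2 := (Nat.ceil_lt_add_one (show 0 ≤ 16 / (ε * h) by positivity)).le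
    rw [← hr] at h2
    calc (r : ℝ) * (ε * h) ≤ (16 / (ε * h) + 1) * (ε * h) := by gcongr
      _ = 16 + ε * h := by field_simp
      _ ≤ 17 := by linarith
  have hr0 : 0 < r := by
    rcases Nat.eq_zero_or_pos r with h2 | h2
    · rw [h2] at hr1
      norm_num at hr1
    · exact h2
  have hr0' : (0 : ℝ) < r := by exact_mod_cast hr0
  set p := m / r with hp
  have hp1 : p * r ≤ m := Nat.div_mul_le_self m r
  have hp2 : (m : ℝ) ≤ (p + 1) * r := by
    have h2 : m < (p + 1) * r := by
      have := Nat.lt_mul_div_succ m hr0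
      rw [mul_comm]
      exact this
    exact_mod_cast h2.le
  have hp3 : h / 2176 * (ε ^ 2 * T) ≤ p := by
    have h2 : ε * T / 64 * (ε * h) ≤ (p + 1) * 17 := by
      calc ε * T / 64 * (ε * h) ≤ (p + 1) * r * (ε * h) := by
            have := hm2.trans hp2
            gcongr
        _ = (p + 1) * (r * (ε * h)) := by ring
        _ ≤ (p + 1) * 17 := by gcongr
    nlinarith
  have hL0 : 0 < 16 * L := by linarith
  set q := ⌊(p : ℝ) / (16 * L)⌋₊ with hq
  have hq1 : 16 * L * q ≤ p := by
    have h2 : (q : ℝ) ≤ p / (16 * L) := Nat.floor_le (by positivity)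
    rw [le_div_iff₀ hL0] at h2
    linarith
  have hq2 : (p : ℝ) ≤ 32 * L * q := by
    have h2 := (Nat.lt_floor_add_one ((p : ℝ) / (16 * L))).le
    rw [← hq, div_le_iff₀ hL0] at h2
    have h3 : 32 * L ≤ p := by nlinarith
    linarith
  have hq3 : 0 < q := by
    rcases Nat.eq_zero_or_pos q with h2 | h2
    · rw [h2] at hq2
      norm_num at hq2
      rw [hq2] at hp3
      norm_num at hp3
      linarith
    · exact h2
  refine ⟨n, m, r, p, q, hn1, hn2, hn3, ?_, hr0, hp1, hr1, by linarith, hp3, hq3, ?_, hq1, hq2⟩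
  · have h2 : (2 * m : ℝ) < n := by nlinarith
    exact_mod_cast h2
  · have h2 : (2 * q : ℝ) ≤ p := by
      have : (0 : ℝ) ≤ q := by positivity
      nlinarith
    have h3 : 2 * q ≤ p := by exact_mod_cast h2
    exact h3.trans (Nat.div_le_self m r)

lemma mul_exp_neg_lt_half {L ℓ : ℝ} {n p q : ℕ} (hL : 2 ≤ L) (hℓ : 8 ≤ ℓ)
    (hn : (n : ℝ) ≤ Real.exp (2 * ℓ)) (hp : 100 * L * ℓ ≤ p) (hq : p ≤ 32 * L * q) :
    n * Real.exp (-(2 * q : ℝ)) < 1 / 2 := by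
  have h1 : 3 * ℓ ≤ 2 * q := by
    have : 100 * ℓ ≤ 32 * q := by
      have h2 : L * (100 * ℓ) ≤ L * (32 * q) := by linarith
      exact le_of_mul_le_mul_left h2 (by linarith)
    linarith
  calc n * Real.exp (-(2 * q : ℝ)) ≤ Real.exp (2 * ℓ) * Real.exp (-(3 * ℓ)) := by gcongr
    _ = Real.exp (-ℓ) := by
      rw [← Real.exp_add]
      congr 1
      ring
    _ ≤ Real.exp (-1) := Real.exp_le_exp.2 (by linarith)
    _ < 1 / 2 := by
      have := Real.exp_neg_one_lt_d9
      linarith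

lemma small_ball_ratio_le {κ L ℓ : ℝ} {n p q : ℕ} (hκ : 0 < κ) (hL : 2 ≤ L)
    (hκL : 16 / κ = Real.exp L) (hℓ : 8 ≤ ℓ) (hn : (n : ℝ) ≤ Real.exp (2 * ℓ))
    (hp : 100 * L * ℓ ≤ p) (hq : 16 * L * q ≤ p) :
    2 * (4 * 16 ^ (2 * q) * (n ^ 2 * Real.exp (-(p / 2 : ℝ)))) / κ ^ (2 * q + 1) ≤
      Real.exp (-(p / 4 : ℝ)) := by
  have h1 : (16 : ℝ) ^ (2 * q) ≤ κ ^ (2 * q + 1) * Real.exp ((2 * q + 1) * L) := by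
    have h2 : Real.exp ((2 * q + 1) * L) = (16 / κ) ^ (2 * q + 1) := by
      rw [hκL, ← Real.exp_nat_mul]
      congr 1
      push_cast
      ring
    rw [h2, ← mul_pow, mul_div_cancel₀ _ hκ.ne']
    exact pow_le_pow_right₀ (by norm_num) (by omega)
  have h3 : (8 : ℝ) ≤ Real.exp ℓ := by
    have := Real.add_one_le_exp ℓ
    linarith
  have h4 : (n : ℝ) ^ 2 ≤ Real.exp (4 * ℓ) := by
    calc (n : ℝ) ^ 2 ≤ Real.exp (2 * ℓ) ^ 2 := by gcongr
      _ = Real.exp (4 * ℓ) := by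
        rw [← Real.exp_nat_mul]
        congr 1
        push_cast
        ring
  rw [div_le_iff₀ (by positivity)]
  calc 2 * (4 * 16 ^ (2 * q) * (n ^ 2 * Real.exp (-(p / 2 : ℝ))))
      = 8 * (16 ^ (2 * q) * (n ^ 2 * Real.exp (-(p / 2 : ℝ)))) := by ring
    _ ≤ Real.exp ℓ * (κ ^ (2 * q + 1) * Real.exp ((2 * q + 1) * L) *
        (Real.exp (4 * ℓ) * Real.exp (-(p / 2 : ℝ)))) := by gcongr
    _ = Real.exp (ℓ + (2 * q + 1) * L + 4 * ℓ + -(p / 2)) * κ ^ (2 * q + 1) := by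
      rw [Real.exp_add, Real.exp_add, Real.exp_add]
      ring
    _ ≤ _ := by
      gcongr
      nlinarith

lemma failure_bound_le {c₁ L ℓ u T : ℝ} {n p q : ℕ} (hL : 2 ≤ L) (hℓ : 8 ≤ ℓ)
    (hTℓ : T = Real.exp ℓ) (hn : (n : ℝ) ≤ T ^ 2) (hc0 : 0 < c₁) (hc1 : c₁ ≤ 1)
    (hu0 : 0 ≤ u) (huT : u ≤ T) (hu : 100 * L * ℓ ≤ c₁ * u) (hp : c₁ * u ≤ p)
    (hq0 : 0 < q) (hq : p ≤ 32 * L * q) :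
    2 ^ n * (2 * Real.exp (-(Real.exp p / 2))) +
      n * 2 ^ (2 * q) * Real.exp (-(p / 4 : ℝ)) ^ q ≤
      Real.exp (-(c₁ ^ 2 / (512 * L) * u ^ 2)) := by
  have h2e : (2 : ℝ) ≤ Real.exp 1 := by
    have := Real.exp_one_gt_d9
    linarith
  have hT1 : 8 ≤ T := by
    have := Real.add_one_le_exp ℓ
    rw [hTℓ]
    linarith
  have hLℓ : 200 * ℓ ≤ 100 * L * ℓ := by nlinarith
  have hLℓ' : 800 * L ≤ 100 * L * ℓ := by nlinarith
  have hpℓ : 200 * ℓ ≤ p := by linarith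
  set v := c₁ ^ 2 / (512 * L) * u ^ 2 with hv
  have hv' : v = (c₁ * u) ^ 2 / (512 * L) := by
    rw [hv]
    ring
  have hv1 : 1 ≤ v := by
    rw [hv', le_div_iff₀ (by linarith)]
    nlinarith
  have hvT : v ≤ T ^ 2 := by
    have h1 : c₁ ^ 2 / (512 * L) ≤ 1 := by
      rw [div_le_one (by linarith)]
      nlinarith
    calc v ≤ 1 * u ^ 2 := by
          rw [hv]
          gcongr
      _ ≤ T ^ 2 := by
          rw [one_mul]
          gcongr
  have hvp : 512 * L * v ≤ p ^ 2 := by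
    have h1 : 512 * L * v = (c₁ * u) ^ 2 := by
      rw [hv']
      field_simp
    rw [h1]
    gcongr
  have hfirst : 2 ^ n * (2 * Real.exp (-(Real.exp p / 2))) ≤ Real.exp (-(2 * v)) := by
    have h1 : 8 * T ^ 2 ≤ Real.exp p := by
      calc 8 * T ^ 2 ≤ T * T ^ 2 := by gcongr
        _ = Real.exp (3 * ℓ) := by
          rw [hTℓ, ← Real.exp_nat_mul, ← Real.exp_add]
          congr 1
          push_cast
          ring
        _ ≤ Real.exp p := Real.exp_le_exp.2 (by linarith)
    calc (2 : ℝ) ^ n * (2 * Real.exp (-(Real.exp p / 2)))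
        ≤ Real.exp 1 ^ n * (Real.exp 1 * Real.exp (-(Real.exp p / 2))) := by gcongr
      _ = Real.exp (n + 1 - Real.exp p / 2) := by
        rw [← Real.exp_nat_mul, ← Real.exp_add, ← Real.exp_add]
        congr 1
        ring
      _ ≤ Real.exp (-(2 * v)) := Real.exp_le_exp.2 (by nlinarith)
  have hsecond : n * 2 ^ (2 * q) * Real.exp (-(p / 4 : ℝ)) ^ q ≤ Real.exp (-(2 * v)) := by
    have hq1 : (1 : ℝ) ≤ q := by exact_mod_cast hq0
    have hpq : (200 * ℓ) * q ≤ p * q := by gcongr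
    have hvq : 16 * v ≤ p * q := by
      have h1 : 512 * L * v ≤ 32 * L * (p * q) := by
        calc 512 * L * v ≤ (p : ℝ) * p := by linarith
          _ ≤ p * (32 * L * q) := by gcongr
          _ = _ := by ring
      have h2 : (32 * L) * (16 * v) ≤ (32 * L) * (p * q) := by linarith
      exact le_of_mul_le_mul_left h2 (by linarith)
    calc (n : ℝ) * 2 ^ (2 * q) * Real.exp (-(p / 4 : ℝ)) ^ q
        ≤ Real.exp (2 * ℓ) * Real.exp 1 ^ (2 * q) * Real.exp (-(p / 4 : ℝ)) ^ q := by
          gcongr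
          refine hn.trans (le_of_eq ?_)
          rw [hTℓ, ← Real.exp_nat_mul]
          push_cast
          ring_nf
      _ = Real.exp (2 * ℓ + 2 * q - p * q / 4) := by
        rw [← Real.exp_nat_mul, ← Real.exp_nat_mul, ← Real.exp_add, ← Real.exp_add]
        congr 1
        push_cast
        ring
      _ ≤ Real.exp (-(2 * v)) := Real.exp_le_exp.2 (by nlinarith)
  have hhalf : Real.exp (-v) ≤ 1 / 2 := by
    calc Real.exp (-v) ≤ Real.exp (-1) := Real.exp_le_exp.2 (by linarith)
      _ ≤ 1 / 2 := by
        have := Real.exp_neg_one_lt_d9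
        linarith
  calc _ ≤ Real.exp (-(2 * v)) + Real.exp (-(2 * v)) := add_le_add hfirst hsecond
    _ = Real.exp (-v) * (2 * Real.exp (-v)) := by
      rw [show -(2 * v) = -v + -v by ring, Real.exp_add]
      ring
    _ ≤ Real.exp (-v) * 1 := by
      gcongr
      linarith
    _ = Real.exp (-v) := mul_one _

lemma density_le_of_card_le {B h ε T : ℝ} {n m k : ℕ} (h0 : 0 < h) (hB0 : 0 ≤ B)
    (hn : 0 < n) (hε0 : 0 < ε) (hβ : B * h ≤ 1) (hnT : n * h ≤ T) (hTn : T ≤ (n + 1) * h)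
    (hm : 16 * (m : ℝ) ≤ ε * h * n) (hεT : 1 ≤ ε * T)
    (hk : (k : ℝ) ≤ B / Real.pi * T - ε * T) :
    Real.pi * (k + 4 * m : ℕ) / n + Real.pi / 4 * (ε * h) ≤ B * h := by
  have hn0 : (0 : ℝ) < n := by exact_mod_cast hn
  have hπ := Real.pi_gt_three
  have h1 : Real.pi * k ≤ B * T - Real.pi * (ε * T) := by
    calc Real.pi * k ≤ Real.pi * (B / Real.pi * T - ε * T) := by gcongr
      _ = _ := by field_simp
  have h2 : B * T ≤ B * ((n + 1) * h) := by gcongr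
  have h3 : ε * (n * h) ≤ ε * T := by gcongr
  have h4 : Real.pi * (16 * m) ≤ Real.pi * (ε * h * n) := by gcongr
  have h5 : Real.pi * (ε * (n * h)) ≤ Real.pi * (ε * T) := by gcongr
  have h6 : Real.pi * 1 ≤ Real.pi * (ε * T) := by gcongr
  have h7 : Real.pi * (k + 4 * m : ℕ) / n + Real.pi / 4 * (ε * h) =
      (Real.pi * k + 4 * (Real.pi * m) + Real.pi / 4 * (ε * h) * n) / n := by
    push_cast
    field_simp
  rw [h7, div_le_iff₀ hn0]
  linarith

lemma div_pow_four_le_of_le_neg_one {x y : ℝ} (hy : y ≤ -1) :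
    (x / y) ^ 4 ≤ x ^ 4 := by
  rw [div_pow]
  refine div_le_self (by positivity) ?_
  have h1 : 1 ≤ (-y) ^ 4 := one_le_pow₀ (by linarith)
  linarith [Even.neg_pow (show Even 4 by decide) y]

end Parameters

theorem undercrowding_upper
    {Ω : Type*} [MeasurableSpace Ω] (P : Measure Ω) [IsProbabilityMeasure P]
    (μ : Measure ℝ) [IsProbabilityMeasure μ]
    (hsymm : μ.map (fun x => -x) = μ)
    (hcpt : Bornology.IsBounded (msupport μ))
    (hac : MeasureTheory.volume.withDensity (μ.rnDeriv MeasureTheory.volume) ≠ 0)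
    (B : ℝ) (hB : B = sInf ((fun x : ℝ => abs x) '' msupport μ))
    (F : ℝ → Ω → ℝ) (hF : IsSGP P μ F) :
    ∃ c > (0:ℝ), ∃ d₁ > (0:ℝ), ∃ d₂ > (0:ℝ), ∀ T ≥ Real.exp 8, ∀ ε : ℝ,
      d₁ * Real.log T / Real.sqrt T ≤ ε → ε ≤ d₂ →
      P {ω | ∃ n : ℕ, zeroCount F T ω = n ∧ (n : ℝ) ≤ B / Real.pi * T - ε * T} ≤
        ENNReal.ofReal (Real.exp (-c * (ε / Real.log ε) ^ 4 * T ^ 2)) := by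
  classical
  obtain ⟨M, hM0, hM⟩ := exists_ae_abs_le hcpt
  have hBl : ∀ᵐ l ∂μ, B ≤ |l| := by
    rw [hB]
    exact ae_sInf_le_abs μ
  have hB0 : 0 ≤ B := by
    rw [hB]
    refine Real.sInf_nonneg ?_
    rintro _ ⟨x, -, rfl⟩
    exact abs_nonneg x
  have hBM : B ≤ M := by
    obtain ⟨l, hl1, hl2⟩ := (hBl.and hM).exists
    exact hl1.trans hl2
  set h := 1 / (2001 * (M + 1)) with hh
  have h0 : 0 < h := by positivity
  have hMh' : (M + 1) * h = 1 / 2001 := by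
    rw [hh]
    field_simp
  have hMh : M * h ≤ 1 / 2001 := by nlinarith
  have hBh : B * h ≤ M * h := by gcongr
  have h1 : h ≤ 1 := by nlinarith [mul_pos hM0 h0]
  obtain ⟨κ, hκ, hκ1, hlow⟩ := exists_pow_mul_sum_sq_le_integral hM hac h0 h1
    (by linarith [mul_comm h M])
  set L := Real.log (16 / κ) with hLdef
  have hκL : 16 / κ = Real.exp L := (Real.exp_log (by positivity)).symm
  have hL : 2 ≤ L := by
    rw [hLdef, Real.le_log_iff_exp_le (by positivity), le_div_iff₀ hκ]
    have h2 : Real.exp 2 = Real.exp 1 * Real.exp 1 := by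
      rw [← Real.exp_add]
      norm_num
    have h3 := Real.exp_one_lt_d9
    have h4 := Real.exp_pos 1
    have h5 : Real.exp 2 ≤ 16 := by
      rw [h2]
      nlinarith
    calc Real.exp 2 * κ ≤ 16 * 1 := by gcongr
      _ = 16 := by norm_num
  set c₁ := h / 2176 with hc₁
  have hc0 : 0 < c₁ := by positivity
  have hc1 : c₁ ≤ 1 := by
    rw [hc₁]
    linarith
  refine ⟨c₁ ^ 2 / (512 * L), by positivity, 100 * L / c₁ + 1, by positivity, Real.exp (-1),
    Real.exp_pos _, fun T hT ε hε hε1 => ?_⟩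
  have hT0 : 0 < T := (Real.exp_pos 8).trans_le hT
  set ℓ := Real.log T with hℓdef
  have hℓ : 8 ≤ ℓ := (Real.le_log_iff_exp_le hT0).2 hT
  have hTℓ : T = Real.exp ℓ := (Real.exp_log hT0).symm
  have hT1 : 1 ≤ T := by
    rw [hTℓ]
    exact Real.one_le_exp (by linarith)
  have hsT : 0 < Real.sqrt T := Real.sqrt_pos.2 hT0
  have hd₁ : 1 ≤ 100 * L / c₁ + 1 := by
    have : 0 ≤ 100 * L / c₁ := by positivity
    linarith
  have hε0 : 0 < ε := lt_of_lt_of_le (by positivity) hε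
  have hεe : ε ≤ 1 := hε1.trans (Real.exp_le_one_iff.2 (by norm_num))
  have hu : 100 * L * ℓ ≤ c₁ * (ε ^ 2 * T) := by
    have h2 : (100 * L / c₁ + 1) * ℓ ≤ ε * Real.sqrt T := (div_le_iff₀ hsT).1 hε
    have h3 : 1 ≤ (100 * L / c₁ + 1) * ℓ := by nlinarith
    have h4 : ε ^ 2 * T = (ε * Real.sqrt T) ^ 2 := by rw [mul_pow, Real.sq_sqrt hT0.le]
    have h5 : 100 * L / c₁ * ℓ ≤ ε ^ 2 * T := by
      rw [h4]
      nlinarith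
    calc 100 * L * ℓ = c₁ * (100 * L / c₁ * ℓ) := by field_simp
      _ ≤ c₁ * (ε ^ 2 * T) := by gcongr
  have huεT : ε ^ 2 * T ≤ ε * T := by
    have : ε ^ 2 ≤ ε := by nlinarith
    gcongr
  have huT : ε ^ 2 * T ≤ T := by nlinarith
  have hεT : 1 ≤ ε * T := by
    have h2 : c₁ * (ε ^ 2 * T) ≤ ε ^ 2 * T := mul_le_of_le_one_left (by positivity) hc1
    nlinarith
  obtain ⟨n, m, r, p, q, hnT, hTn, hn2, hmn, hr, hpr, hrε, hm, hp, hq, hqm, hq1, hq2⟩ :=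
    exists_discretization h0 h1 hL hℓ hT1 hε0 hεe hu
  have hπ := Real.pi_gt_three
  have hnℓ : (n : ℝ) ≤ Real.exp (2 * ℓ) := by
    refine hn2.trans (le_of_eq ?_)
    rw [hTℓ, ← Real.exp_nat_mul]
    push_cast
    ring_nf
  have hpℓ := hu.trans hp
  have hmain := hF.measure_zeroCount_le (n := n) (m := m) (r := r) (p := p) (q := q)
    (η := Real.pi / 4 * (ε * h)) (S := B / Real.pi * T - ε * T) (T := T)
    (ρ := Real.exp (-(p / 4 : ℝ))) hBl hM h0 hnT hmn hr hpr (by positivity)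
    (by
      have h2 := Real.exp_one_lt_d9
      calc 4 * Real.exp 1 ≤ Real.pi / 4 * 16 := by linarith
        _ ≤ Real.pi / 4 * (r * (ε * h)) := by gcongr
        _ = _ := by ring) (by linarith) (by linarith)
    (fun k hk => density_le_of_card_le h0 hB0 (by omega) hε0 (by linarith) hnT hTn hm hεT hk)
    hq hqm (mul_exp_neg_lt_half hL hℓ hnℓ hpℓ hq2) hκ hlow
    (small_ball_ratio_le hκ hL hκL hℓ hnℓ hpℓ hq1)
    (Real.exp_le_one_iff.2 (neg_nonpos.2 (by positivity)))
  refine hmain.trans (ENNReal.ofReal_le_ofReal ((failure_bound_le hL hℓ hTℓ hn2 hc0 hc1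
    (by positivity) huT hu hp hq hq2).trans (Real.exp_le_exp.2 ?_)))
  have hlog : Real.log ε ≤ -1 := (Real.log_le_iff_le_exp hε0).2 hε1
  have hratio := div_pow_four_le_of_le_neg_one (x := ε) hlog
  have h2 : (ε / Real.log ε) ^ 4 * T ^ 2 ≤ (ε ^ 2 * T) ^ 2 := by
    calc (ε / Real.log ε) ^ 4 * T ^ 2 ≤ ε ^ 4 * T ^ 2 := by gcongr
      _ = _ := by ring
  have h3 : c₁ ^ 2 / (512 * L) * ((ε / Real.log ε) ^ 4 * T ^ 2) ≤
      c₁ ^ 2 / (512 * L) * (ε ^ 2 * T) ^ 2 := by gcongr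
  linarith
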